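/- arXiv:1912.12908 — 3 statements merged into one kernel-verified Lean document; each statement's English description precedes it below -/
import Mathlib

section
/- Every large game possesses a symmetric randomized strategy robust perfect equilibrium; that is, there exists a randomized strategy robust perfect equilibrium h : I → Δ such that h(i) = h(i′) whenever u_i = u_{i′}. -/
open MeasureTheory Filter Topology

section RobustPerfect

variable {I : Type*} [MeasurableSpace I] {A : Type*} [Fintype A]

/-- The societal summary of a randomized strategy profile. -/
noncomputable def socSum (lam : Measure I) (h : I → A → ℝ) : A → ℝ :=
  fun a => ∫ i, h i a ∂lam

/-- `h` is a randomized strategy profile: a measurable map into the simplex. -/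
def IsProfile (lam : Measure I) (h : I → A → ℝ) : Prop :=
  Measurable h ∧ ∀ i, h i ∈ stdSimplex ℝ A

/-- A large game: payoffs continuous on the simplex and measurable in the player. -/
def IsLargeGame (u : I → A → (A → ℝ) → ℝ) : Prop :=
  (∀ i a, ContinuousOn (u i a) (stdSimplex ℝ A)) ∧
  (∀ (a : A) (τ : A → ℝ), τ ∈ stdSimplex ℝ A → Measurable fun i => u i a τ)

/-- An atomless measure. -/
def MeasAtomless (lam : Measure I) : Prop :=
  ∀ s : Set I, MeasurableSet s → 0 < lam s →
    ∃ t : Set I, MeasurableSet t ∧ t ⊆ s ∧ 0 < lam t ∧ lam t < lam s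

/-- A Borel probability measure concentrated on the simplex with full support on it. -/
def FullSupportOnSimplex (η : Measure (A → ℝ)) : Prop :=
  IsProbabilityMeasure η ∧ η (stdSimplex ℝ A)ᶜ = 0 ∧
    ∀ U : Set (A → ℝ), IsOpen U → (U ∩ stdSimplex ℝ A).Nonempty → 0 < η U

/-- A perturbation function: a Borel measurable map from the simplex to the
full-support Borel probability measures on the simplex. -/
def IsPerturbation (φ : (A → ℝ) → Measure (A → ℝ)) : Prop :=
  (∀ τ ∈ stdSimplex ℝ A, FullSupportOnSimplex (φ τ)) ∧
  ∀ f : (A → ℝ) → ℝ, Continuous f → Measurable fun τ => ∫ x, f x ∂(φ τ)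

/-- Expected payoff of action `a` against a distribution over societal summaries. -/
noncomputable def payM (ui : A → (A → ℝ) → ℝ) (a : A) (ν : Measure (A → ℝ)) : ℝ :=
  ∫ τ, ui a τ ∂ν

/-- Randomized strategy Nash equilibrium. -/
def IsNash (lam : Measure I) (u : I → A → (A → ℝ) → ℝ) (h : I → A → ℝ) : Prop :=
  IsProfile lam h ∧
  ∀ᵐ i ∂lam, ∀ μ ∈ stdSimplex ℝ A,
    ∑ a, μ a * u i a (socSum lam h) ≤ ∑ a, h i a * u i a (socSum lam h)

/-- A weakly dominated action. -/
def WeaklyDominated (ui : A → (A → ℝ) → ℝ) (a : A) : Prop :=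
  ∃ μ ∈ stdSimplex ℝ A,
    (∀ τ ∈ stdSimplex ℝ A, ui a τ ≤ ∑ b, μ b * ui b τ) ∧
    (∃ τ ∈ stdSimplex ℝ A, ui a τ < ∑ b, μ b * ui b τ)

/-- Admissibility: almost no player puts weight on a weakly dominated action. -/
def Admissible (lam : Measure I) (u : I → A → (A → ℝ) → ℝ) (h : I → A → ℝ) : Prop :=
  ∀ᵐ i ∂lam, ∀ a : A, WeaklyDominated (u i) a → h i a = 0

/-- Weak convergence of a sequence of measures to a Dirac measure. -/
def WeakTendstoDirac (ν : ℕ → Measure (A → ℝ)) (τ : A → ℝ) : Prop :=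
  ∀ f : (A → ℝ) → ℝ, Continuous f →
    Tendsto (fun n => ∫ x, f x ∂(ν n)) atTop (nhds (f τ))

/-- Aggregate robustness. -/
def AggregateRobust (lam : Measure I) (u : I → A → (A → ℝ) → ℝ) (h : I → A → ℝ) : Prop :=
  ∀ᵐ i ∂lam, ∃ φ : ℕ → (A → ℝ) → Measure (A → ℝ),
    (∀ n, IsPerturbation (φ n)) ∧
    (∀ τ ∈ stdSimplex ℝ A, WeakTendstoDirac (fun n => φ n τ) τ) ∧
    ∀ n, ∀ μ ∈ stdSimplex ℝ A,
      ∑ a, μ a * payM (u i) a (φ n (socSum lam h)) ≤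
        ∑ a, h i a * payM (u i) a (φ n (socSum lam h))

/-- `ε`-robust perfect equilibrium with perturbed player space `Iε` and
perturbation function `φ`. -/
def IsEpsRPE (lam : Measure I) (u : I → A → (A → ℝ) → ℝ) (ε : ℝ)
    (h : I → A → ℝ) (Iε : Set I) (φ : (A → ℝ) → Measure (A → ℝ)) : Prop :=
  IsProfile lam h ∧
  (∀ᵐ i ∂lam, ∀ a : A, 0 < h i a) ∧
  MeasurableSet Iε ∧ ENNReal.ofReal (1 - ε) < lam Iε ∧
  IsPerturbation φ ∧
  (∀ τ ∈ stdSimplex ℝ A, ENNReal.ofReal (1 - ε) ≤ φ τ {τ}) ∧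
  ∀ i ∈ Iε, ∀ am al : A,
    payM (u i) am (φ (socSum lam h)) < payM (u i) al (φ (socSum lam h)) →
      h i am ≤ ε

/-- Robust perfect equilibrium. -/
def IsRPE (lam : Measure I) (u : I → A → (A → ℝ) → ℝ) (h : I → A → ℝ) : Prop :=
  IsProfile lam h ∧
  ∃ (ε : ℕ → ℝ) (hs : ℕ → I → A → ℝ) (Is : ℕ → Set I)
      (φs : ℕ → (A → ℝ) → Measure (A → ℝ)),
    (∀ n, 0 < ε n) ∧ Tendsto ε atTop (nhds 0) ∧
    (∀ n, IsEpsRPE lam u (ε n) (hs n) (Is n) (φs n)) ∧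
    (∀ᵐ i ∂lam, ∃ nk : ℕ → ℕ, StrictMono nk ∧ (∀ k, i ∈ Is (nk k)) ∧
      Tendsto (fun k => hs (nk k) i) atTop (nhds (h i))) ∧
    Tendsto (fun n => socSum lam (hs n)) atTop (nhds (socSum lam h))

/-- The Dirac randomized strategy profile induced by a pure strategy profile. -/
def diracProfile [DecidableEq A] (f : I → A) : I → A → ℝ :=
  fun i a => if a = f i then 1 else 0

end RobustPerfect

/-- A finite set is dominant for a family of rankings if no point lies strictly above its
minimum in every ranking. -/
def Dominant {V ι : Type*} (r : ι → V → ℕ) (s : Finset V) : Prop :=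
  ∀ y, ∃ i, ∀ x ∈ s, r i y ≤ r i x

theorem Dominant.mono {V ι : Type*} {r : ι → V → ℕ} {s t : Finset V} (ht : Dominant r t)
    (hst : s ⊆ t) : Dominant r s := fun y =>
  let ⟨i, hi⟩ := ht y
  ⟨i, fun x hx => hi x (hst hx)⟩

open Classical in
theorem Dominant.card_insert_eq_two {V ι : Type*} [Fintype V] [Fintype ι]
    {r : ι → V → ℕ} (hr : ∀ i, Function.Injective (r i)) {s : Finset V} (hs : Dominant r s)
    (hcard : s.card + 1 = Fintype.card ι) (hne : s.Nonempty)
    (hup : ∀ i, ∃ y, ∀ l, l ≠ i → ∃ x ∈ s, r l x < r l y) :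
    (Finset.univ.filter fun y => y ∉ s ∧ Dominant r (insert y s)).card = 2 := by
  choose m hms hmin using fun i => s.exists_min_image (r i) hne
  have hsurj : ∀ x ∈ s, ∃ i, m i = x := by
    intro x hx
    obtain ⟨i, hi⟩ := hs x
    exact ⟨i, hr i (le_antisymm (hmin i x hx) (hi _ (hms i)))⟩
  obtain ⟨i, -, j, -, hij, hmij⟩ := Finset.exists_ne_map_eq_of_card_lt_of_maps_to
    (s := (Finset.univ : Finset ι)) (t := s) (f := m) (by rw [Finset.card_univ]; omega)
    (fun i _ => hms i)
  have hY : ∀ k, ∃ y, (∀ l, l ≠ k → r l (m l) < r l y) ∧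
      ∀ z, (∀ l, l ≠ k → r l (m l) < r l z) → r k z ≤ r k y := by
    intro k
    have hnon : (Finset.univ.filter fun y => ∀ l, l ≠ k → r l (m l) < r l y).Nonempty := by
      obtain ⟨y, hy⟩ := hup k
      refine ⟨y, Finset.mem_filter.2 ⟨Finset.mem_univ _, fun l hl => ?_⟩⟩
      obtain ⟨x, hx, hxy⟩ := hy l hl
      exact (hmin l x hx).trans_lt hxy
    obtain ⟨y, hy, hmax⟩ := Finset.exists_max_image _ (r k) hnon
    exact ⟨y, (Finset.mem_filter.1 hy).2,
      fun z hz => hmax z (Finset.mem_filter.2 ⟨Finset.mem_univ _, hz⟩)⟩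
  choose Y hYgt hYmax using hY
  have hins : ∀ k, (∃ k', k' ≠ k ∧ m k' = m k) → Y k ∉ s ∧ Dominant r (insert (Y k) s) := by
    rintro k ⟨k', hk', hm⟩
    refine ⟨fun hmem => ?_, fun z => ?_⟩
    · obtain ⟨l, hl⟩ := hsurj _ hmem
      by_cases hlk : l = k
      · subst hlk
        have := hYgt l k' hk'
        rw [hm, hl] at this
        exact lt_irrefl _ this
      · have := hYgt k l hlk
        rw [hl] at this
        exact lt_irrefl _ this
    · by_cases hz : ∀ l, l ≠ k → r l (m l) < r l z
      · refine ⟨k, fun x hx => ?_⟩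
        rcases Finset.mem_insert.1 hx with rfl | hxs
        · exact hYmax k z hz
        · obtain ⟨l, hl⟩ := hs z
          by_cases hlk : l = k
          · subst hlk
            exact hl x hxs
          · exact absurd (hl _ (hms l)) (not_le.2 (hz l hlk))
      · push Not at hz
        obtain ⟨l, hlk, hl⟩ := hz
        refine ⟨l, fun x hx => ?_⟩
        rcases Finset.mem_insert.1 hx with rfl | hx
        · exact hl.trans (hYgt k l hlk).le
        · exact hl.trans (hmin l x hx)
  have hYne : Y i ≠ Y j := by
    intro h
    obtain ⟨l, hl⟩ := hs (Y i)
    have h1 := hl _ (hms l)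
    by_cases hli : l = i
    · subst hli
      exact absurd (h ▸ h1) (not_le.2 (hYgt j l hij))
    · exact absurd h1 (not_le.2 (hYgt i l hli))
  have hset : (Finset.univ.filter fun y => y ∉ s ∧ Dominant r (insert y s)) = {Y i, Y j} := by
    ext y
    simp only [Finset.mem_filter, Finset.mem_univ, true_and, Finset.mem_insert,
      Finset.mem_singleton]
    constructor
    · rintro ⟨hys, hdom⟩
      obtain ⟨k, hk⟩ := hdom y
      have hkm : r k y < r k (m k) :=
        lt_of_le_of_ne (hk _ (Finset.mem_insert_of_mem (hms k)))
          (fun h => hys (hr k h ▸ hms k))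
      have hl : ∀ x : s, ∃ l, m l = x ∧ r l x < r l y := by
        rintro ⟨x, hx⟩
        obtain ⟨l, hl⟩ := hdom x
        refine ⟨l, hr l (le_antisymm (hmin l x hx) (hl _ (Finset.mem_insert_of_mem (hms l)))),
          lt_of_le_of_ne (hl _ (Finset.mem_insert_self _ _)) (fun h => hys (hr l h ▸ hx))⟩
      choose L hLm hLy using hl
      have hLinj : Function.Injective L := by
        intro a b hab
        apply Subtype.ext
        rw [← hLm a, ← hLm b, hab]
      have himg : Finset.univ.image L = Finset.univ.erase k := by
        apply Finset.eq_of_subset_of_card_le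
        · intro l hl
          obtain ⟨x, -, rfl⟩ := Finset.mem_image.1 hl
          refine Finset.mem_erase.2 ⟨fun h => ?_, Finset.mem_univ _⟩
          have h1 := hLy x
          rw [← hLm x, h] at h1
          exact absurd h1 (not_lt.2 hkm.le)
        · rw [Finset.card_image_of_injective _ hLinj, Finset.card_erase_of_mem (Finset.mem_univ _),
            Finset.card_univ, Finset.card_univ, Fintype.card_coe]
          omega
      have hall : ∀ l, l ≠ k → r l (m l) < r l y ∧ ∃ x, L x = l := by
        intro l hlk
        have : l ∈ Finset.univ.image L := himg ▸ Finset.mem_erase.2 ⟨hlk, Finset.mem_univ _⟩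
        obtain ⟨x, -, rfl⟩ := Finset.mem_image.1 this
        exact ⟨by rw [hLm]; exact hLy x, x, rfl⟩
      have hyk : y = Y k := by
        obtain ⟨l, hl⟩ := hdom (Y k)
        by_cases hlk : l = k
        · subst hlk
          exact hr l (le_antisymm (hYmax l y fun l' h => (hall l' h).1)
            (hl _ (Finset.mem_insert_self _ _)))
        · exact absurd (hl _ (Finset.mem_insert_of_mem (hms l))) (not_le.2 (hYgt k l hlk))
      by_cases hki : k = i
      · exact Or.inl (hki ▸ hyk)
      by_cases hkj : k = j
      · exact Or.inr (hkj ▸ hyk)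
      obtain ⟨a, ha⟩ := (hall i (Ne.symm hki)).2
      obtain ⟨b, hb⟩ := (hall j (Ne.symm hkj)).2
      have hab : a = b := by
        apply Subtype.ext
        rw [← hLm a, ← hLm b, ha, hb, hmij]
      exact absurd (by rw [← ha, ← hb, hab]) hij
    · rintro (rfl | rfl)
      · exact hins i ⟨j, hij.symm, hmij.symm⟩
      · exact hins j ⟨i, hij, hmij⟩
  rw [hset, Finset.card_pair hYne]

open Classical in
theorem even_card_filter_erase_image {V ι : Type*} [Fintype ι] (c : V → ι) (i₀ : ι)
    {ρ : Finset V} (hcard : ρ.card = Fintype.card ι) (hne : ρ.image c ≠ Finset.univ) :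
    Even (ρ.filter fun x => (ρ.erase x).image c = Finset.univ.erase i₀).card := by
  rcases Finset.eq_empty_or_nonempty
    (ρ.filter fun x => (ρ.erase x).image c = Finset.univ.erase i₀) with h | ⟨x₀, hx₀⟩
  · rw [h]; simp
  obtain ⟨hx₀ρ, himg⟩ := Finset.mem_filter.1 hx₀
  have hinj : Set.InjOn c (ρ.erase x₀) := by
    rw [← Finset.card_image_iff, himg, Finset.card_erase_of_mem hx₀ρ,
      Finset.card_erase_of_mem (Finset.mem_univ _), hcard, Finset.card_univ]
  have hc₀ : c x₀ ∈ (ρ.erase x₀).image c := by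
    rw [himg]
    refine Finset.mem_erase.2 ⟨fun h => hne ?_, Finset.mem_univ _⟩
    rw [← Finset.insert_erase hx₀ρ, Finset.image_insert, himg, h,
      Finset.insert_erase (Finset.mem_univ _)]
  obtain ⟨x₁, hx₁, hc₁⟩ := Finset.mem_image.1 hc₀
  obtain ⟨hx₁₀, hx₁ρ⟩ := Finset.mem_erase.1 hx₁
  have hset : (ρ.filter fun x => (ρ.erase x).image c = Finset.univ.erase i₀) = {x₀, x₁} := by
    ext x
    simp only [Finset.mem_filter, Finset.mem_insert, Finset.mem_singleton]
    constructor
    · rintro ⟨hxρ, hx⟩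
      by_contra! hcon
      have hcx : c x ∈ (ρ.erase x).image c := by
        rw [hx, ← himg]
        exact Finset.mem_image_of_mem _ (Finset.mem_erase.2 ⟨hcon.1, hxρ⟩)
      obtain ⟨x', hx', hcx'⟩ := Finset.mem_image.1 hcx
      obtain ⟨hx'x, hx'ρ⟩ := Finset.mem_erase.1 hx'
      have hxm : x ∈ (ρ.erase x₀ : Finset V) := Finset.mem_erase.2 ⟨hcon.1, hxρ⟩
      by_cases h : x' = x₀
      · subst h
        exact hcon.2 (hinj hxm hx₁ (by rw [← hcx', hc₁]))
      · exact hx'x (hinj (Finset.mem_coe.2 (Finset.mem_erase.2 ⟨h, hx'ρ⟩)) hxm hcx')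
    · rintro (rfl | rfl)
      · exact ⟨hx₀ρ, himg⟩
      · refine ⟨hx₁ρ, ?_⟩
        rw [← himg]
        ext a
        simp only [Finset.mem_image, Finset.mem_erase]
        constructor
        · rintro ⟨z, ⟨hz, hzρ⟩, rfl⟩
          by_cases h : z = x₀
          · exact ⟨x, ⟨hx₁₀, hx₁ρ⟩, by rw [hc₁, h]⟩
          · exact ⟨z, ⟨h, hzρ⟩, rfl⟩
        · rintro ⟨z, ⟨hz, hzρ⟩, rfl⟩
          by_cases h : z = x
          · exact ⟨x₀, ⟨hx₁₀.symm, hx₀ρ⟩, by rw [← hc₁, h]⟩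
          · exact ⟨z, ⟨h, hzρ⟩, rfl⟩
  rw [hset, Finset.card_pair hx₁₀.symm]
  exact even_two

open Classical in
/-- Scarf's combinatorial lemma: for rankings with slack points there is a dominant set carrying
every colour. -/
theorem exists_dominant_colorful {V ι : Type*} [Fintype V] [Fintype ι] [Nonempty ι]
    {r : ι → V → ℕ} (hr : ∀ i, Function.Injective (r i)) {sl : ι → V}
    (hsl : Function.Injective sl) (hlow : ∀ i v, r i (sl i) ≤ r i v)
    (hhigh : ∀ i j v, j ≠ i → v ∉ Set.range sl → r i v < r i (sl j))
    (hT : ∃ v, v ∉ Set.range sl) (c : V → ι) (hc : ∀ i, c (sl i) = i) :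
    ∃ s : Finset V, Dominant r s ∧ s.card = Fintype.card ι ∧ s.image c = Finset.univ := by
  by_contra! hno
  obtain ⟨i₀⟩ := ‹Nonempty ι›
  have hK : 0 < Fintype.card ι := Fintype.card_pos_iff.2 ⟨i₀⟩
  set doors : Finset (Finset V) := Finset.univ.filter fun d =>
    Dominant r d ∧ d.card + 1 = Fintype.card ι ∧ d.image c = Finset.univ.erase i₀ with hdoors
  set rooms : Finset (Finset V) := Finset.univ.filter fun ρ =>
    Dominant r ρ ∧ ρ.card = Fintype.card ι with hrooms
  set s₀ : Finset V := (Finset.univ.erase i₀).image sl with hs₀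
  have hcount := Finset.sum_card_bipartiteAbove_eq_sum_card_bipartiteBelow
    (s := doors) (t := rooms) (fun d ρ => d ⊆ ρ)
  have hbelow : ∀ ρ ∈ rooms, Even (doors.bipartiteBelow (fun d ρ => d ⊆ ρ) ρ).card := by
    intro ρ hρ
    obtain ⟨-, hdom, hcard⟩ := Finset.mem_filter.1 hρ
    have : doors.bipartiteBelow (fun d ρ => d ⊆ ρ) ρ =
        (ρ.filter fun x => (ρ.erase x).image c = Finset.univ.erase i₀).image ρ.erase := by
      ext d
      simp only [Finset.mem_bipartiteBelow, hdoors, Finset.mem_filter, Finset.mem_univ, true_and,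
        Finset.mem_image]
      constructor
      · rintro ⟨⟨-, hdc, himg⟩, hsub⟩
        obtain ⟨x, hx, hins⟩ : ∃ x ∉ d, insert x d = ρ := by
          refine Finset.exists_eq_insert_iff.2 ⟨hsub, by omega⟩
        subst hins
        refine ⟨x, ⟨Finset.mem_insert_self _ _, ?_⟩, ?_⟩ <;> rw [Finset.erase_insert hx]
        exact himg
      · rintro ⟨x, ⟨hx, himg⟩, rfl⟩
        refine ⟨⟨hdom.mono (Finset.erase_subset _ _), ?_, himg⟩, Finset.erase_subset _ _⟩
        rw [Finset.card_erase_of_mem hx]; omega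
    rw [this, Finset.card_image_of_injOn]
    · exact even_card_filter_erase_image c i₀ hcard (hno ρ hdom hcard)
    · intro x hx y hy hxy
      by_contra hne
      have : x ∈ ρ.erase y := Finset.mem_erase.2 ⟨hne, (Finset.mem_filter.1 hx).1⟩
      rw [← show ρ.erase x = ρ.erase y from hxy] at this
      exact Finset.notMem_erase _ _ this
  have habove : ∀ d ∈ doors, (rooms.bipartiteAbove (fun d ρ => d ⊆ ρ) d).card =
      (Finset.univ.filter fun y => y ∉ d ∧ Dominant r (insert y d)).card := by
    intro d hd
    obtain ⟨-, -, hdc, -⟩ := Finset.mem_filter.1 hd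
    have : rooms.bipartiteAbove (fun d ρ => d ⊆ ρ) d =
        (Finset.univ.filter fun y => y ∉ d ∧ Dominant r (insert y d)).image (insert · d) := by
      ext ρ
      simp only [Finset.mem_bipartiteAbove, hrooms, Finset.mem_filter, Finset.mem_univ, true_and,
        Finset.mem_image]
      constructor
      · rintro ⟨⟨hdom, hcard⟩, hsub⟩
        obtain ⟨x, hx, hins⟩ : ∃ x ∉ d, insert x d = ρ := by
          refine Finset.exists_eq_insert_iff.2 ⟨hsub, by omega⟩
        exact ⟨x, ⟨hx, hins ▸ hdom⟩, hins⟩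
      · rintro ⟨x, ⟨hx, hdom⟩, rfl⟩
        exact ⟨⟨hdom, by rw [Finset.card_insert_of_notMem hx, hdc]⟩, Finset.subset_insert _ _⟩
    rw [this, Finset.card_image_of_injOn]
    intro x hx y hy hxy
    have hx' := (Finset.mem_filter.1 hx).2.1
    have : x ∈ insert y d := by
      rw [← show insert x d = insert y d from hxy]; exact Finset.mem_insert_self _ _
    exact (Finset.mem_insert.1 this).resolve_right hx'
  have hmem₀ : ∀ x ∈ s₀, ∃ j, j ≠ i₀ ∧ sl j = x := by
    intro x hx
    obtain ⟨j, hj, rfl⟩ := Finset.mem_image.1 hx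
    exact ⟨j, (Finset.mem_erase.1 hj).1, rfl⟩
  have hs₀door : s₀ ∈ doors := by
    refine Finset.mem_filter.2 ⟨Finset.mem_univ _, fun y => ?_, ?_, ?_⟩
    · by_cases hy : y ∈ Set.range sl
      · obtain ⟨j, rfl⟩ := hy
        exact ⟨j, fun x _ => hlow j x⟩
      · refine ⟨i₀, fun x hx => ?_⟩
        obtain ⟨j, hj, rfl⟩ := hmem₀ x hx
        exact (hhigh i₀ j y hj hy).le
    · rw [hs₀, Finset.card_image_of_injective _ hsl, Finset.card_erase_of_mem (Finset.mem_univ _),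
        Finset.card_univ]
      omega
    · rw [hs₀, Finset.image_image]
      rw [show c ∘ sl = id from funext hc, Finset.image_id]
  have hone : (Finset.univ.filter fun y => y ∉ s₀ ∧ Dominant r (insert y s₀)).card = 1 := by
    obtain ⟨y₀, hy₀, hmax⟩ := Finset.exists_max_image
      (Finset.univ.filter fun v => v ∉ Set.range sl) (r i₀)
      (by obtain ⟨v, hv⟩ := hT; exact ⟨v, by simpa using hv⟩)
    have hy₀' : y₀ ∉ Set.range sl := (Finset.mem_filter.1 hy₀).2
    have hmax' : ∀ v, v ∉ Set.range sl → r i₀ v ≤ r i₀ y₀ := fun v hv =>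
      hmax v (Finset.mem_filter.2 ⟨Finset.mem_univ _, hv⟩)
    have hnot : ∀ y z, z ∉ Set.range sl → ∀ i, (∀ x ∈ insert y s₀, r i z ≤ r i x) → i = i₀ := by
      intro y z hz i hi
      by_contra hne
      have h1 := hi (sl i) (Finset.mem_insert_of_mem
        (Finset.mem_image_of_mem _ (Finset.mem_erase.2 ⟨hne, Finset.mem_univ _⟩)))
      exact hz ⟨i, hr i (le_antisymm (hlow i z) h1)⟩
    rw [Finset.card_eq_one]
    refine ⟨y₀, ?_⟩
    ext y
    simp only [Finset.mem_filter, Finset.mem_univ, true_and, Finset.mem_singleton]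
    constructor
    · rintro ⟨hys, hdom⟩
      obtain ⟨i, hi⟩ := hdom y₀
      have hii := hnot y y₀ hy₀' i hi
      subst hii
      have h1 := hi y (Finset.mem_insert_self _ _)
      by_cases hy : y ∈ Set.range sl
      · obtain ⟨j, rfl⟩ := hy
        by_cases hj : j = i
        · subst hj
          exact absurd ⟨j, hr j (le_antisymm (hlow j y₀) h1)⟩ hy₀'
        · exact absurd (Finset.mem_image_of_mem _
            (Finset.mem_erase.2 ⟨hj, Finset.mem_univ _⟩)) hys
      · exact hr i (le_antisymm (hmax' y hy) h1)
    · rintro rfl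
      refine ⟨fun h => ?_, fun z => ?_⟩
      · obtain ⟨j, -, rfl⟩ := hmem₀ y h
        exact hy₀' ⟨j, rfl⟩
      · by_cases hz : z ∈ Set.range sl
        · obtain ⟨j, rfl⟩ := hz
          exact ⟨j, fun x _ => hlow j x⟩
        · refine ⟨i₀, fun x hx => ?_⟩
          rcases Finset.mem_insert.1 hx with rfl | hx
          · exact hmax' z hz
          · obtain ⟨j, hj, rfl⟩ := hmem₀ x hx
            exact (hhigh i₀ j z hj hz).le
  have htwo : ∀ d ∈ doors, d ≠ s₀ →
      (Finset.univ.filter fun y => y ∉ d ∧ Dominant r (insert y d)).card = 2 := by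
    intro d hd hne
    obtain ⟨-, hdom, hdc, himg⟩ := Finset.mem_filter.1 hd
    obtain ⟨t, htd, ht⟩ : ∃ t ∈ d, t ∉ Set.range sl := by
      by_contra! hall
      apply hne
      apply Finset.eq_of_subset_of_card_le
      · intro x hx
        obtain ⟨j, rfl⟩ := hall x hx
        refine Finset.mem_image_of_mem _ ?_
        rw [← himg, ← hc j]
        exact Finset.mem_image_of_mem _ hx
      · have := (Finset.mem_filter.1 hs₀door).2.2.1
        omega
    refine hdom.card_insert_eq_two hr hdc ⟨t, htd⟩ fun i => ⟨sl i, fun l hl => ?_⟩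
    exact ⟨t, htd, hhigh l i t hl.symm ht⟩
  rw [Finset.sum_congr rfl habove, ← Finset.add_sum_erase _ _ hs₀door, hone,
    Finset.sum_congr rfl (fun d hd => htwo d (Finset.mem_of_mem_erase hd)
      (Finset.ne_of_mem_erase hd)), Finset.sum_const, smul_eq_mul] at hcount
  have heven := Finset.even_sum _ hbelow
  rw [← hcount] at heven
  rw [Nat.even_iff] at heven
  omega

open Classical in
theorem exists_close_grid_points {A : Type*} [Fintype A] [Nonempty A] {m : ℕ}
    (c : (A → ℕ) → A) :
    ∃ (C : Finset A) (σ : Set (A → ℕ)), σ.Nonempty ∧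
      (∀ x ∈ σ, ∑ a, x a = m) ∧ (∀ i ∈ C, ∃ x ∈ σ, c x = i) ∧
      (∀ x ∈ σ, ∀ y ∈ σ, ∀ i, x i ≤ y i + Fintype.card A) ∧
      (∀ i ∉ C, ∀ x ∈ σ, x i ≤ Fintype.card A) := by
  set T := {x : A → ℕ // x ∈ Finset.piAntidiag (Finset.univ : Finset A) m} with hT
  have hTsum : ∀ x : T, ∑ a, x.1 a = m := fun x => (Finset.mem_piAntidiag.1 x.2).1
  have hTle : ∀ (x : T) i, x.1 i ≤ m := fun x i =>
    (Finset.single_le_sum (f := x.1) (fun _ _ => Nat.zero_le _) (Finset.mem_univ i)).trans_eq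
      (hTsum x)
  set N := Fintype.card T
  let e : T ≃ Fin N := Fintype.equivFin T
  let e' : A ≃ Fin (Fintype.card A) := Fintype.equivFin A
  let r : A → T ⊕ A → ℕ := fun i v => Sum.elim
    (fun x => 1 + (N * x.1 i + (e x).1))
    (fun j => if j = i then 0 else 1 + (N * (m + 1) + (e' j).1)) v
  have hlt : ∀ (x : T) i, N * x.1 i + (e x).1 < N * (m + 1) := by
    intro x i
    have h1 : N * x.1 i ≤ N * m := Nat.mul_le_mul_left _ (hTle x i)
    have := (e x).2
    rw [Nat.mul_succ]; omega
  have hN : ∀ x : T, 0 < N := fun x => Fintype.card_pos_iff.2 ⟨x⟩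
  have hmono : ∀ (x y : T) i, r i (Sum.inl x) ≤ r i (Sum.inl y) → x.1 i ≤ y.1 i := by
    intro x y i h
    by_contra! hcon
    have h1 : N * (y.1 i + 1) ≤ N * x.1 i := Nat.mul_le_mul_left _ hcon
    have h2 := (e y).2
    simp only [r, Sum.elim_inl] at h
    rw [Nat.mul_succ] at h1
    omega
  have hr : ∀ i, Function.Injective (r i) := by
    rintro i (x | j) (y | k) h
    · have h1 : x.1 i = y.1 i := le_antisymm (hmono _ _ _ h.le) (hmono _ _ _ h.ge)
      simp only [r, Sum.elim_inl, h1] at h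
      have : e x = e y := Fin.ext (by omega)
      rw [e.injective this]
    · have := hlt x i
      simp only [r, Sum.elim_inl, Sum.elim_inr] at h
      split_ifs at h <;> omega
    · have := hlt y i
      simp only [r, Sum.elim_inl, Sum.elim_inr] at h
      split_ifs at h <;> omega
    · simp only [r, Sum.elim_inr] at h
      split_ifs at h with h1 h2 h2
      · rw [h1, h2]
      · omega
      · omega
      · have : e' j = e' k := Fin.ext (by omega)
        rw [e'.injective this]
  have hrange : ∀ v : T ⊕ A, v ∉ Set.range (Sum.inr : A → T ⊕ A) → ∃ x, v = Sum.inl x := by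
    rintro (x | j) h
    · exact ⟨x, rfl⟩
    · exact absurd ⟨j, rfl⟩ h
  have hgrid : ∀ y : A → ℕ, ∑ a, y a = m → y ∈ Finset.piAntidiag (Finset.univ : Finset A) m :=
    fun y hy => Finset.mem_piAntidiag.2 ⟨hy, fun _ _ => Finset.mem_univ _⟩
  have hTne : Nonempty T := by
    obtain ⟨a₀⟩ := ‹Nonempty A›
    exact ⟨⟨Pi.single a₀ m, hgrid _ (by simp)⟩⟩
  obtain ⟨s, hdom, -, himg⟩ := exists_dominant_colorful (r := r) hr (sl := Sum.inr)
    Sum.inr_injective (fun i v => by simp [r])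
    (fun i j v hj hv => by
      obtain ⟨x, rfl⟩ := hrange v hv
      have := hlt x i
      simp only [r, Sum.elim_inl, Sum.elim_inr, if_neg hj]
      omega)
    (by obtain ⟨x⟩ := hTne; exact ⟨Sum.inl x, by simp⟩)
    (fun v => Sum.elim (fun x => c x.1) id v) (fun i => rfl)
  have hkey : ∀ y : T, ∃ i, Sum.inr i ∉ s ∧ ∀ x, Sum.inl x ∈ s → y.1 i ≤ x.1 i := by
    intro y
    obtain ⟨i, hi⟩ := hdom (Sum.inl y)
    refine ⟨i, fun h => ?_, fun x hx => hmono _ _ _ (hi _ hx)⟩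
    have := hi _ h
    simp [r] at this
  have hcol : ∀ i, Sum.inr i ∉ s → ∃ x, Sum.inl x ∈ s ∧ c x.1 = i := by
    intro i hi
    have : i ∈ s.image fun v : T ⊕ A => Sum.elim (fun x => c x.1) id v := by
      rw [himg]; exact Finset.mem_univ _
    obtain ⟨v, hv, hvi⟩ := Finset.mem_image.1 this
    rcases v with x | j
    · exact ⟨x, hv, hvi⟩
    · exact absurd ((show j = i from hvi) ▸ hv) hi
  obtain ⟨i₁, hi₁, -⟩ := hkey hTne.some
  obtain ⟨x₁, hx₁, -⟩ := hcol i₁ hi₁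
  set C : Finset A := Finset.univ.filter fun i => Sum.inr i ∉ s with hC
  have hσne : (Finset.univ.filter fun x : T => Sum.inl x ∈ s).Nonempty := ⟨x₁, by simpa using hx₁⟩
  choose lo hlo hlomin using fun i => Finset.exists_min_image
    (Finset.univ.filter fun x : T => Sum.inl x ∈ s) (fun x => x.1 i) hσne
  have hlo_le : ∀ x : T, Sum.inl x ∈ s → ∀ i, (lo i).1 i ≤ x.1 i := fun x hx i =>
    hlomin i x (by simpa using hx)
  have hsum : m < ∑ i ∈ C, ((lo i).1 i + 1) := by
    by_contra! hcon
    let y : A → ℕ := fun i => (if i ∈ C then (lo i).1 i + 1 else 0) +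
      (if i = i₁ then m - ∑ i ∈ C, ((lo i).1 i + 1) else 0)
    have hy : ∑ a, y a = m := by
      simp only [y]
      rw [Finset.sum_add_distrib, Finset.sum_ite_mem, Finset.univ_inter, Finset.sum_ite_eq',
        if_pos (Finset.mem_univ _)]
      exact Nat.add_sub_cancel' hcon
    obtain ⟨i, hi, hle⟩ := hkey ⟨y, hgrid y hy⟩
    have h1 := hle (lo i) (by simpa using hlo i)
    have h2 : i ∈ C := by simpa [hC] using hi
    simp only [y, if_pos h2] at h1
    omega
  have hCcard : C.card ≤ Fintype.card A := Finset.card_le_univ C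
  have hsplit : ∑ i ∈ C, ((lo i).1 i + 1) = ∑ i ∈ C, (lo i).1 i + C.card := by
    simp [Finset.sum_add_distrib]
  have hup : ∀ x : T, Sum.inl x ∈ s → ∀ i,
      x.1 i ≤ (if i ∈ C then (lo i).1 i else 0) + Fintype.card A := by
    intro x hx i
    have h1 := hTsum x
    rw [← Finset.sum_add_sum_compl C] at h1
    split_ifs with hi
    · have h2 := Finset.sum_le_sum (s := C.erase i) fun j _ => hlo_le x hx j
      rw [← Finset.add_sum_erase C _ hi] at h1
      rw [← Finset.add_sum_erase C (fun i => (lo i).1 i) hi] at hsplit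
      omega
    · have h2 := Finset.sum_le_sum (s := C) fun j _ => hlo_le x hx j
      have h3 := Finset.single_le_sum (f := x.1) (s := Cᶜ) (fun _ _ => Nat.zero_le _)
        (Finset.mem_compl.2 hi)
      omega
  refine ⟨C, {x | ∃ x' : T, Sum.inl x' ∈ s ∧ x'.1 = x}, ⟨x₁.1, x₁, hx₁, rfl⟩, ?_, ?_, ?_, ?_⟩
  · rintro _ ⟨x, -, rfl⟩
    exact hTsum x
  · intro i hi
    obtain ⟨x, hx, hcx⟩ := hcol i (by simpa [hC] using hi)
    exact ⟨x.1, ⟨x, hx, rfl⟩, hcx⟩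
  · rintro _ ⟨x, hx, rfl⟩ _ ⟨y, hy, rfl⟩ i
    have h1 := hup x hx i
    have h2 := hlo_le y hy i
    split_ifs at h1 <;> omega
  · rintro i hi _ ⟨x, hx, rfl⟩
    have h1 := hup x hx i
    rw [if_neg hi] at h1
    omega

theorem exists_approx_fixedPoint_stdSimplex {A : Type*} [Fintype A] [Nonempty A]
    {F : (A → ℝ) → A → ℝ} (hmaps : Set.MapsTo F (stdSimplex ℝ A) (stdSimplex ℝ A))
    {m : ℕ} (hm : 0 < m) :
    ∃ z ∈ stdSimplex ℝ A, ∀ i, ∃ x ∈ stdSimplex ℝ A,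
      (∀ a, |x a - z a| ≤ (Fintype.card A : ℝ) / m) ∧ z i ≤ F x i + (Fintype.card A : ℝ) / m := by
  have hm' : (0 : ℝ) < m := by exact_mod_cast hm
  let sc : (A → ℕ) → A → ℝ := fun x a => (x a : ℝ) / m
  have hsc : ∀ x : A → ℕ, ∑ a, x a = m → sc x ∈ stdSimplex ℝ A := by
    intro x hx
    refine ⟨fun a => by positivity, ?_⟩
    simp only [sc]
    rw [← Finset.sum_div, ← Nat.cast_sum, hx, div_self hm'.ne']
  have hcol : ∀ x : A → ℕ, ∃ i, ∑ a, x a = m → sc x i ≤ F (sc x) i := by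
    intro x
    by_cases hx : ∑ a, x a = m
    · by_contra! hcon
      have h1 : ∑ i, F (sc x) i < ∑ i, sc x i :=
        Finset.sum_lt_sum_of_nonempty Finset.univ_nonempty fun i _ => (hcon i).2
      rw [(hmaps (hsc x hx)).2, (hsc x hx).2] at h1
      exact lt_irrefl _ h1
    · exact ⟨Classical.arbitrary A, fun h => absurd h hx⟩
  choose c hc using hcol
  obtain ⟨C, σ, ⟨z, hz⟩, hsum, hcC, hclose, hout⟩ := exists_close_grid_points (m := m) c
  have hle : ∀ x ∈ σ, ∀ y ∈ σ, ∀ i, sc x i ≤ sc y i + (Fintype.card A : ℝ) / m := by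
    intro x hx y hy i
    simp only [sc]
    rw [← add_div]
    gcongr
    exact_mod_cast hclose x hx y hy i
  refine ⟨sc z, hsc z (hsum z hz), fun i => ?_⟩
  by_cases hi : i ∈ C
  · obtain ⟨x, hx, rfl⟩ := hcC i hi
    refine ⟨sc x, hsc x (hsum x hx), fun a => ?_, ?_⟩
    · rw [abs_le]
      constructor <;> linarith [hle x hx z hz a, hle z hz x hx a]
    · linarith [hle z hz x hx (c x), hc x (hsum x hx)]
  · refine ⟨sc z, hsc z (hsum z hz), fun a => by simp; positivity, ?_⟩
    have h1 : sc z i ≤ (Fintype.card A : ℝ) / m := by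
      simp only [sc]
      gcongr
      exact_mod_cast hout i hi z hz
    linarith [(hmaps (hsc z (hsum z hz))).1 i]

/-- **Brouwer's fixed point theorem** for the standard simplex. -/
theorem exists_fixedPoint_stdSimplex {A : Type*} [Fintype A] [Nonempty A]
    {F : (A → ℝ) → A → ℝ} (hF : ContinuousOn F (stdSimplex ℝ A))
    (hmaps : Set.MapsTo F (stdSimplex ℝ A) (stdSimplex ℝ A)) :
    ∃ x ∈ stdSimplex ℝ A, F x = x := by
  choose z hz x hx hxz hzF using fun n : ℕ =>
    exists_approx_fixedPoint_stdSimplex hmaps (Nat.succ_pos n)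
  obtain ⟨w, hw, ns, hns, hlim⟩ := (isCompact_stdSimplex ℝ A).tendsto_subseq hz
  have hsmall : Tendsto (fun k => (Fintype.card A : ℝ) / ((ns k).succ : ℕ)) atTop (𝓝 0) :=
    tendsto_const_nhds.div_atTop
      (tendsto_natCast_atTop_atTop.comp ((tendsto_add_atTop_nat 1).comp hns.tendsto_atTop))
  have hle : ∀ i, w i ≤ F w i := by
    intro i
    have hxlim : Tendsto (fun k => x (ns k) i) atTop (𝓝[stdSimplex ℝ A] w) := by
      refine tendsto_nhdsWithin_iff.2 ⟨tendsto_pi_nhds.2 fun a => ?_,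
        Eventually.of_forall fun k => hx _ _⟩
      have h1 : Tendsto (fun k => x (ns k) i a - z (ns k) a) atTop (𝓝 0) :=
        squeeze_zero_norm (fun k => hxz (ns k) i a) hsmall
      simpa using h1.add (tendsto_pi_nhds.1 hlim a)
    have h2 : Tendsto (fun k => F (x (ns k) i) i) atTop (𝓝 (F w i)) :=
      tendsto_pi_nhds.1 ((hF w hw).tendsto.comp hxlim) i
    have h3 := h2.add hsmall
    rw [add_zero] at h3
    exact le_of_tendsto_of_tendsto' (tendsto_pi_nhds.1 hlim i) h3 fun k => hzF (ns k) i
  refine ⟨w, hw, ?_⟩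
  have heq : ∑ i, w i = ∑ i, F w i := by rw [hw.2, (hmaps hw).2]
  funext i
  exact ((Finset.sum_eq_sum_iff_of_le fun i _ => hle i).1 heq i (Finset.mem_univ _)).symm

theorem exists_measurable_subset_measureReal_eq (μ : Measure ℝ) [IsFiniteMeasure μ]
    [NullSingletonClass μ] {E : Set ℝ} (hE : MeasurableSet E) {c : ℝ} (hc : 0 ≤ c)
    (hcE : c ≤ μ.real E) : ∃ E' ⊆ E, MeasurableSet E' ∧ μ.real E' = c := by
  rcases hc.eq_or_lt with rfl | hc
  · exact ⟨∅, Set.empty_subset _, MeasurableSet.empty, by simp⟩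
  rcases hcE.eq_or_lt with rfl | hcE
  · exact ⟨E, subset_rfl, hE, rfl⟩
  set ν := μ.restrict E
  have hcont : Continuous fun t : ℝ => ν.real (Set.Iic t) := by
    have heq : (fun t : ℝ => ν.real (Set.Iic t)) =
        fun t => ∫ x, (Set.Iic t).indicator (1 : ℝ → ℝ) x ∂ν := by
      funext t
      rw [integral_indicator_one measurableSet_Iic]
    rw [heq, continuous_iff_continuousAt]
    intro t₀
    refine continuousAt_of_dominated (bound := fun _ => (1 : ℝ)) (Eventually.of_forall fun t =>
      (measurable_one.indicator measurableSet_Iic).aestronglyMeasurable)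
      (Eventually.of_forall fun t => Eventually.of_forall fun x => ?_) (integrable_const _) ?_
    · by_cases h : x ∈ Set.Iic t <;> simp [Set.indicator, h]
    · have hne : ∀ᵐ x ∂ν, x ≠ t₀ := by simp [ae_iff]
      filter_upwards [hne] with x hx
      rcases lt_or_gt_of_ne hx with h | h
      · refine ContinuousAt.congr (f := fun _ => (1 : ℝ)) continuousAt_const ?_
        filter_upwards [lt_mem_nhds h] with t ht
        simp [Set.indicator, ht.le]
      · refine ContinuousAt.congr (f := fun _ => (0 : ℝ)) continuousAt_const ?_
        filter_upwards [gt_mem_nhds h] with t ht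
        simp [Set.indicator, ht]
  have htop : Tendsto (fun t : ℝ => ν.real (Set.Iic t)) atTop (𝓝 (μ.real E)) := by
    have h1 := (ENNReal.tendsto_toReal (measure_ne_top ν Set.univ)).comp
      (tendsto_measure_Iic_atTop ν)
    simpa [ν, Measure.real, Measure.restrict_apply_univ, Function.comp_def] using h1
  have hbot : Tendsto (fun t : ℝ => ν.real (Set.Iic t)) atBot (𝓝 0) := by
    have h1 := tendsto_measure_iInter_atBot (μ := ν) (s := fun t : ℝ => Set.Iic t)
      (fun _ => measurableSet_Iic.nullMeasurableSet) (fun _ _ h => Set.Iic_subset_Iic.2 h)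
      ⟨0, measure_ne_top _ _⟩
    have h2 : ⋂ t : ℝ, Set.Iic t = ∅ := by
      ext x
      simp only [Set.mem_iInter, Set.mem_Iic, Set.mem_empty_iff_false, iff_false, not_forall,
        not_le]
      exact exists_lt x
    rw [h2, measure_empty] at h1
    simpa [Measure.real, Function.comp_def] using
      (ENNReal.tendsto_toReal ENNReal.zero_ne_top).comp h1
  obtain ⟨t, ht⟩ := mem_range_of_exists_le_of_exists_ge hcont
    ((hbot.eventually (eventually_le_nhds hc)).exists)
    ((htop.eventually (eventually_ge_nhds hcE)).exists)
  refine ⟨E ∩ Set.Iic t, Set.inter_subset_left, hE.inter measurableSet_Iic, ?_⟩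
  rw [← ht, Set.inter_comm]
  simp [ν, Measure.real, Measure.restrict_apply measurableSet_Iic]

/-- A finite measure on the line without point masses can be split into pieces of prescribed
masses. -/
theorem exists_measurable_partition_real {A : Type*} [Fintype A] [Nonempty A] [MeasurableSpace A]
    [MeasurableSingletonClass A] (μ : Measure ℝ) [IsFiniteMeasure μ] [NullSingletonClass μ]
    {p : A → ℝ} (hp : ∀ a, 0 ≤ p a) (hsum : ∑ a, p a = μ.real Set.univ) :
    ∃ γ : ℝ → A, Measurable γ ∧ ∀ a, μ.real (γ ⁻¹' {a}) = p a := by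
  classical
  suffices H : ∀ (s : Finset A) (p : A → ℝ) (E : Set ℝ), MeasurableSet E → (∀ a, 0 ≤ p a) →
      (∀ a ∉ s, p a = 0) → ∑ a, p a = μ.real E →
      ∃ γ : ℝ → A, Measurable γ ∧ ∀ a, μ.real (E ∩ γ ⁻¹' {a}) = p a by
    simpa using H Finset.univ p Set.univ MeasurableSet.univ hp (by simp) hsum
  intro s
  induction s using Finset.induction_on with
  | empty =>
    intro p E hE hp hps hsum
    refine ⟨fun _ => Classical.arbitrary A, measurable_const, fun a => ?_⟩
    have h0 : μ.real E = 0 := by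
      rw [← hsum]; exact Finset.sum_eq_zero fun a _ => hps a (Finset.notMem_empty a)
    rw [hps a (Finset.notMem_empty a)]
    exact le_antisymm (h0 ▸ measureReal_mono Set.inter_subset_left) measureReal_nonneg
  | insert a s has ih =>
    intro p E hE hp hps hsum
    have hle : p a ≤ μ.real E := by
      rw [← hsum]; exact Finset.single_le_sum (fun b _ => hp b) (Finset.mem_univ a)
    obtain ⟨E', hE'E, hE', hμE'⟩ := exists_measurable_subset_measureReal_eq μ hE (hp a) hle
    obtain ⟨γ, hγ, hγp⟩ := ih (Function.update p a 0) (E \ E') (hE.diff hE')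
      (fun b => by by_cases h : b = a <;> simp [Function.update, h, hp])
      (fun b hb => by
        by_cases h : b = a
        · simp [h]
        · rw [Function.update_of_ne h]
          exact hps b (by simp [h, hb]))
      (by
        rw [measureReal_sdiff hE'E hE', hμE', ← hsum, Finset.sum_update_of_mem (Finset.mem_univ a),
          ← Finset.add_sum_erase _ _ (Finset.mem_univ a), Finset.sdiff_singleton_eq_erase]
        ring)
    refine ⟨E'.piecewise (fun _ => a) γ, Measurable.piecewise hE' measurable_const hγ,
      fun b => ?_⟩
    have hpre : E ∩ (E'.piecewise (fun _ => a) γ) ⁻¹' {b} =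
        (if b = a then E' else ∅) ∪ ((E \ E') ∩ γ ⁻¹' {b}) := by
      ext x
      by_cases hx : x ∈ E'
      · by_cases hb : b = a
        · simp [hx, hb, hE'E hx]
        · simp [hx, hb, Ne.symm hb]
      · by_cases hb : b = a <;> simp [hx, hb]
    have hdisj : Disjoint (if b = a then E' else ∅) ((E \ E') ∩ γ ⁻¹' {b}) := by
      split_ifs
      · exact Set.disjoint_left.2 fun x hx hx' => hx'.1.2 hx
      · simp
    rw [hpre, measureReal_union hdisj ((hE.diff hE').inter (hγ (measurableSet_singleton b))), hγp]
    by_cases hb : b = a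
    · simp [hb, hμE']
    · simp [hb]

theorem exists_measurable_partition {I A : Type*} [MeasurableSpace I] [Fintype A] [Nonempty A]
    [MeasurableSpace A] [MeasurableSingletonClass A] (ν : Measure I) [IsFiniteMeasure ν]
    {θ : I → ℝ} (hθ : Measurable θ) {E : Set I}
    (hatom : ∀ t, ν (E ∩ θ ⁻¹' {t}) = 0)
    {p : A → ℝ} (hp : ∀ a, 0 ≤ p a) (hsum : ∑ a, p a = ν.real E) :
    ∃ γ : ℝ → A, Measurable γ ∧ ∀ a, ν.real (E ∩ θ ⁻¹' (γ ⁻¹' {a})) = p a := by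
  have happ : ∀ s, MeasurableSet s → ((ν.restrict E).map θ) s = ν (E ∩ θ ⁻¹' s) := by
    intro s hs
    rw [Measure.map_apply hθ hs, Measure.restrict_apply (hθ hs), Set.inter_comm]
  have : NullSingletonClass ((ν.restrict E).map θ) :=
    ⟨fun t => by rw [happ _ (measurableSet_singleton t), hatom]⟩
  obtain ⟨γ, hγ, hγp⟩ := exists_measurable_partition_real ((ν.restrict E).map θ) hp (by
    rw [hsum, Measure.real, Measure.real, happ _ MeasurableSet.univ]; simp)
  refine ⟨γ, hγ, fun a => ?_⟩
  rw [← hγp a, Measure.real, Measure.real, happ _ (hγ (measurableSet_singleton a))]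

theorem integrable_coord_of_mem_stdSimplex {I A : Type*} [MeasurableSpace I] [Fintype A]
    {ν : Measure I} [IsFiniteMeasure ν] {g : I → A → ℝ} (hg : Measurable g)
    (hgΔ : ∀ i, g i ∈ stdSimplex ℝ A) (a : A) : Integrable (fun i => g i a) ν :=
  Integrable.of_bound ((measurable_pi_apply a).comp hg).aestronglyMeasurable 1
    (Eventually.of_forall fun i => by
      rw [Real.norm_of_nonneg ((hgΔ i).1 a)]
      exact (mem_Icc_of_mem_stdSimplex (hgΔ i) a).2)

theorem integral_eq_sum_setIntegral_fiber {I κ : Type*} [MeasurableSpace I] [Fintype κ]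
    {ν : Measure I} {D : I → κ} (hD : ∀ k, MeasurableSet (D ⁻¹' {k})) {f : I → ℝ}
    (hf : Integrable f ν) : ∫ i, f i ∂ν = ∑ k, ∫ i in D ⁻¹' {k}, f i ∂ν := by
  rw [← integral_iUnion_fintype hD _ fun k => hf.integrableOn]
  · rw [show ⋃ k, D ⁻¹' {k} = Set.univ from Set.eq_univ_of_forall fun i => by simp,
      setIntegral_univ]
  · intro k l hkl
    exact Disjoint.preimage D (by simpa using hkl)

/-- Limits of the action masses that a sequence of profiles puts on finitely many cells. -/
theorem exists_limit_cell_masses {I A κ : Type*} [MeasurableSpace I] [Fintype A] [Fintype κ]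
    (ν : Measure I) [IsFiniteMeasure ν] {D : I → κ} (hD : ∀ k, MeasurableSet (D ⁻¹' {k}))
    {g : ℕ → I → A → ℝ} (hg : ∀ n, Measurable (g n)) (hgΔ : ∀ n i, g n i ∈ stdSimplex ℝ A)
    {σ : A → ℝ} (hσ : ∀ a, Tendsto (fun n => ∫ i, g n i a ∂ν) atTop (𝓝 (σ a))) :
    ∃ P : κ → A → ℝ, (∀ k a, 0 ≤ P k a) ∧ (∀ k, ∑ a, P k a = ν.real (D ⁻¹' {k})) ∧
      (∀ a, ∑ k, P k a = σ a) ∧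
      ∀ k a, (∀ i, D i = k → Tendsto (fun n => g n i a) atTop (𝓝 0)) → P k a = 0 := by
  have hcoord : ∀ n a (ν' : Measure I) [IsFiniteMeasure ν'], Integrable (fun i => g n i a) ν' :=
    fun n a ν' _ => integrable_coord_of_mem_stdSimplex (hg n) (hgΔ n) a
  have hnn : ∀ n k a, 0 ≤ ∫ i in D ⁻¹' {k}, g n i a ∂ν := fun n k a =>
    integral_nonneg fun i => (hgΔ n i).1 a
  have hmass : ∀ n k, ∑ a, ∫ i in D ⁻¹' {k}, g n i a ∂ν = ν.real (D ⁻¹' {k}) := by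
    intro n k
    rw [← integral_finsetSum _ fun a _ => hcoord n a _]
    simp [(hgΔ n _).2]
  obtain ⟨P, -, ns, hns, hP⟩ :=
    (isCompact_univ_pi fun k : κ => isCompact_univ_pi fun _ : A =>
      isCompact_Icc (a := (0 : ℝ)) (b := ν.real (D ⁻¹' {k}))).tendsto_subseq
      (x := fun n k a => ∫ i in D ⁻¹' {k}, g n i a ∂ν) (fun n k _ a _ => ⟨hnn n k a, by
        rw [← hmass n k]
        exact Finset.single_le_sum (f := fun a => ∫ i in D ⁻¹' {k}, g n i a ∂ν)
          (fun b _ => hnn n k b) (Finset.mem_univ a)⟩)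
  have hP' : ∀ k a, Tendsto (fun n => ∫ i in D ⁻¹' {k}, g (ns n) i a ∂ν) atTop (𝓝 (P k a)) :=
    fun k a => tendsto_pi_nhds.1 (tendsto_pi_nhds.1 hP k) a
  refine ⟨P, fun k a => ge_of_tendsto' (hP' k a) fun n => hnn _ k a, fun k => ?_, fun a => ?_,
    fun k a h0 => ?_⟩
  · refine tendsto_nhds_unique (tendsto_finsetSum _ fun a _ => hP' k a) ?_
    simp only [hmass]
    exact tendsto_const_nhds
  · refine tendsto_nhds_unique (tendsto_finsetSum _ fun k _ => hP' k a) ?_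
    have h1 := (hσ a).comp hns.tendsto_atTop
    refine h1.congr fun n => ?_
    exact integral_eq_sum_setIntegral_fiber hD (hcoord _ a ν)
  · refine tendsto_nhds_unique (hP' k a) ?_
    rw [show (0 : ℝ) = ∫ i in D ⁻¹' {k}, (0 : ℝ) ∂ν by simp]
    refine tendsto_integral_of_dominated_convergence (fun _ => (1 : ℝ))
      (fun n => (hcoord _ a _).aestronglyMeasurable) (integrable_const _) (fun n => ?_) ?_
    · refine Eventually.of_forall fun i => ?_
      rw [Real.norm_of_nonneg ((hgΔ _ i).1 a)]
      exact (mem_Icc_of_mem_stdSimplex (hgΔ _ i) a).2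
    · filter_upwards [ae_restrict_mem (hD k)] with i hi
      exact (h0 i hi).comp hns.tendsto_atTop

open Classical in
/-- On a part of the player space where `θ` has no atoms, the limit of aggregate actions is
realized by a pure profile selecting actions that are used infinitely often. -/
theorem exists_pure_limit_selection {I A : Type*} [MeasurableSpace I] [Fintype A] [Nonempty A]
    (ν : Measure I) [IsFiniteMeasure ν] {θ : I → ℝ} (hθ : Measurable θ)
    (hatom : ∀ t, ν (θ ⁻¹' {t}) = 0)
    {g : ℕ → I → A → ℝ} (hg : ∀ n, Measurable (g n)) (hgΔ : ∀ n i, g n i ∈ stdSimplex ℝ A)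
    {σ : A → ℝ} (hσ : ∀ a, Tendsto (fun n => ∫ i, g n i a ∂ν) atTop (𝓝 (σ a))) :
    ∃ f : I → A, (∀ a, MeasurableSet (f ⁻¹' {a})) ∧ (∀ a, ν.real (f ⁻¹' {a}) = σ a) ∧
      (∀ᵐ i ∂ν, ∃ᶠ n in atTop, 0 < g n i (f i)) ∧
      ∀ i i', θ i = θ i' → (∀ n, g n i = g n i') → f i = f i' := by
  let : MeasurableSpace A := ⊤
  let S : I → Finset A := fun i => Finset.univ.filter fun a => ∃ᶠ n in atTop, 0 < g n i a
  have hSa : ∀ a, MeasurableSet {i | ∃ᶠ n in atTop, 0 < g n i a} := by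
    intro a
    simp only [frequently_atTop]
    have h : {i | ∀ N, ∃ n ≥ N, 0 < g n i a} = ⋂ N, ⋃ n ≥ N, {i | 0 < g n i a} := by
      ext i; simp
    rw [h]
    exact MeasurableSet.iInter fun N => MeasurableSet.iUnion fun n => MeasurableSet.iUnion fun _ =>
      measurableSet_lt measurable_const ((measurable_pi_apply a).comp (hg n))
  have hS : ∀ k, MeasurableSet (S ⁻¹' {k}) := by
    intro k
    have h : S ⁻¹' {k} = ⋂ a, {i | (∃ᶠ n in atTop, 0 < g n i a) ↔ a ∈ k} := by
      ext i
      simp [S, Finset.ext_iff]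
    rw [h]
    refine MeasurableSet.iInter fun a => ?_
    by_cases ha : a ∈ k
    · simpa [ha] using hSa a
    · simp only [ha, iff_false]
      exact (hSa a).compl
  obtain ⟨P, hP0, hPk, hPa, hPz⟩ := exists_limit_cell_masses ν hS hg hgΔ hσ
  choose γ hγ hγP using fun k => exists_measurable_partition ν hθ
    (fun t => measure_mono_null Set.inter_subset_right (hatom t)) (hP0 k) (hPk k)
  let f : I → A := fun i => γ (S i) (θ i)
  have hfib : ∀ a k, f ⁻¹' {a} ∩ S ⁻¹' {k} = S ⁻¹' {k} ∩ θ ⁻¹' (γ k ⁻¹' {a}) := by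
    intro a k
    ext i
    simp only [f, Set.mem_inter_iff, Set.mem_preimage, Set.mem_singleton_iff]
    constructor
    · rintro ⟨h1, rfl⟩; exact ⟨rfl, h1⟩
    · rintro ⟨rfl, h1⟩; exact ⟨h1, rfl⟩
  have hf : ∀ a, MeasurableSet (f ⁻¹' {a}) := by
    intro a
    have h : f ⁻¹' {a} = ⋃ k, S ⁻¹' {k} ∩ θ ⁻¹' (γ k ⁻¹' {a}) := by
      simp_rw [← hfib]
      ext i; simp
    rw [h]
    exact MeasurableSet.iUnion fun k => (hS k).inter (hθ (hγ k (measurableSet_singleton a)))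
  refine ⟨f, hf, fun a => ?_, ?_, fun i i' h1 h2 => ?_⟩
  · have hcoord : Integrable ((f ⁻¹' {a}).indicator (1 : I → ℝ)) ν :=
      (integrable_const (1 : ℝ)).indicator (hf a)
    rw [← hPa a, ← integral_indicator_one (hf a), integral_eq_sum_setIntegral_fiber hS hcoord]
    refine Finset.sum_congr rfl fun k _ => ?_
    rw [← hγP k a, ← hfib, integral_indicator_one (hf a), measureReal_restrict_apply (hf a)]
  · have hnull : ∀ k, ∀ a ∉ k, ∀ᵐ i ∂ν, ¬ (i ∈ S ⁻¹' {k} ∩ θ ⁻¹' (γ k ⁻¹' {a})) := by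
      intro k a ha
      have h0 : P k a = 0 := hPz k a fun i hi => by
        have h1 : ¬ ∃ᶠ n in atTop, 0 < g n i a := fun h => ha (hi ▸ by simpa [S] using h)
        refine tendsto_const_nhds.congr' ?_
        filter_upwards [not_frequently.1 h1] with n hn
        exact le_antisymm ((hgΔ n i).1 a) (not_lt.1 hn)
      rw [← hγP k a, measureReal_eq_zero_iff] at h0
      exact measure_eq_zero_iff_ae_notMem.1 h0
    have hall : ∀ᵐ i ∂ν, ∀ k, ∀ a, a ∉ k → ¬ (i ∈ S ⁻¹' {k} ∩ θ ⁻¹' (γ k ⁻¹' {a})) :=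
      ae_all_iff.2 fun k => ae_all_iff.2 fun a => by
        by_cases ha : a ∈ k
        · simp [ha]
        · simpa [ha] using hnull k a ha
    filter_upwards [hall] with i hi
    by_contra hcon
    exact hi (S i) (f i) (by simpa [S] using hcon) ⟨rfl, rfl⟩
  · simp only [f, S, h1, h2]

open Classical in
/-- The actions maximizing a payoff vector. -/
noncomputable def bestActions {A : Type*} [Fintype A] (v : A → ℝ) : Finset A :=
  Finset.univ.filter fun a => ∀ b, v b ≤ v a

theorem mem_bestActions {A : Type*} [Fintype A] {v : A → ℝ} {a : A} :
    a ∈ bestActions v ↔ ∀ b, v b ≤ v a := by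
  simp [bestActions]

theorem bestActions_nonempty {A : Type*} [Fintype A] [Nonempty A] (v : A → ℝ) :
    (bestActions v).Nonempty := by
  obtain ⟨a, ha⟩ := Finite.exists_max v
  exact ⟨a, mem_bestActions.2 ha⟩

theorem measurableSet_bestActions_fiber {I A : Type*} [MeasurableSpace I] [Fintype A]
    {v : I → A → ℝ} (hv : ∀ a, Measurable fun i => v i a) (B : Finset A) :
    MeasurableSet ((fun i => bestActions (v i)) ⁻¹' {B}) := by
  have h : (fun i => bestActions (v i)) ⁻¹' {B} =
      ⋂ a, {i | (∀ b, v i b ≤ v i a) ↔ a ∈ B} := by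
    ext i
    simp [Finset.ext_iff, mem_bestActions]
  have hle : ∀ a, MeasurableSet {i | ∀ b, v i b ≤ v i a} := fun a => by
    rw [Set.ofPred_forall]
    exact MeasurableSet.iInter fun b => measurableSet_le (hv b) (hv a)
  rw [h]
  refine MeasurableSet.iInter fun a => ?_
  by_cases ha : a ∈ B
  · simpa [ha] using hle a
  · simp only [ha, iff_false]
    exact (hle a).compl

/-- The logit choice rule with precision `t`. -/
noncomputable def logit {A : Type*} [Fintype A] (t : ℝ) (v : A → ℝ) (a : A) : ℝ :=
  Real.exp (t * v a) / ∑ b, Real.exp (t * v b)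

theorem sum_exp_pos {A : Type*} [Fintype A] [Nonempty A] (v : A → ℝ) :
    0 < ∑ b, Real.exp (v b) :=
  Finset.sum_pos (fun _ _ => Real.exp_pos _) Finset.univ_nonempty

theorem logit_mem_stdSimplex {A : Type*} [Fintype A] [Nonempty A] (t : ℝ) (v : A → ℝ) :
    logit t v ∈ stdSimplex ℝ A := by
  have h := sum_exp_pos fun b => t * v b
  refine ⟨fun a => (div_pos (Real.exp_pos _) h).le, ?_⟩
  simp only [logit]
  rw [← Finset.sum_div, div_self h.ne']

theorem logit_le_exp {A : Type*} [Fintype A] (t : ℝ) (v : A → ℝ) (a b : A) :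
    logit t v a ≤ Real.exp (t * (v a - v b)) := by
  rw [mul_sub, Real.exp_sub]
  exact div_le_div_of_nonneg_left (Real.exp_pos _).le (Real.exp_pos _)
    (Finset.single_le_sum (f := fun b => Real.exp (t * v b)) (fun _ _ => (Real.exp_pos _).le)
      (Finset.mem_univ b))

theorem continuous_logit {A : Type*} [Fintype A] [Nonempty A] (t : ℝ) (a : A) :
    Continuous fun v : A → ℝ => logit t v a := by
  unfold logit
  exact Continuous.div (by fun_prop) (by fun_prop) fun v => (sum_exp_pos fun b => t * v b).ne'

theorem tendsto_logit_of_notMem_bestActions {A : Type*} [Fintype A] [Nonempty A]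
    {t : ℕ → ℝ} (ht : Tendsto t atTop atTop) {v : ℕ → A → ℝ} {v' : A → ℝ}
    (hv : ∀ a, Tendsto (fun n => v n a) atTop (𝓝 (v' a))) {a : A} (ha : a ∉ bestActions v') :
    Tendsto (fun n => logit (t n) (v n) a) atTop (𝓝 0) := by
  obtain ⟨b, hb⟩ : ∃ b, v' a < v' b := by simpa [mem_bestActions] using ha
  have h1 : Tendsto (fun n => t n * (v n a - v n b)) atTop atBot :=
    ht.atTop_mul_neg (sub_neg.2 hb) ((hv a).sub (hv b))
  exact squeeze_zero (fun n => (logit_mem_stdSimplex (t n) (v n)).1 a)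
    (fun n => logit_le_exp (t n) (v n) a b) (Real.tendsto_exp_atBot.comp h1)

/-- Aggregate form of the existence of a Nash equilibrium in a large game: best responses to
`σ`, mixed in a way that depends only on the set of best responses, aggregate to `σ`. -/
theorem exists_aggregate_equilibrium {I A : Type*} [MeasurableSpace I] [Fintype A] [Nonempty A]
    (lam : Measure I) [IsProbabilityMeasure lam] {w : I → A → (A → ℝ) → ℝ}
    (hwc : ∀ i a, ContinuousOn (w i a) (stdSimplex ℝ A))
    (hwm : ∀ a, ∀ τ ∈ stdSimplex ℝ A, Measurable fun i => w i a τ) :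
    ∃ σ ∈ stdSimplex ℝ A, ∃ q : Finset A → A → ℝ, (∀ B, q B ∈ stdSimplex ℝ A) ∧
      (∀ B, B.Nonempty → ∀ a ∉ B, q B a = 0) ∧
      ∀ a, ∫ i, q (bestActions fun b => w i b σ) a ∂lam = σ a := by
  classical
  have hlm : ∀ (t : ℝ), ∀ τ ∈ stdSimplex ℝ A, Measurable fun i => logit t fun b => w i b τ :=
    fun t τ hτ => measurable_pi_lambda _ fun a =>
      (continuous_logit t a).measurable.comp (measurable_pi_lambda _ fun b => hwm b τ hτ)
  have hfix : ∀ n : ℕ, ∃ τ ∈ stdSimplex ℝ A,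
      (fun a => ∫ i, logit n (fun b => w i b τ) a ∂lam) = τ := by
    intro n
    refine exists_fixedPoint_stdSimplex
      (F := fun τ a => ∫ i, logit n (fun b => w i b τ) a ∂lam) ?_ ?_
    · refine continuousOn_pi.2 fun a => ?_
      refine continuousOn_of_dominated (bound := fun _ => (1 : ℝ)) (fun τ hτ =>
        ((measurable_pi_apply a).comp (hlm n τ hτ)).aestronglyMeasurable)
        (fun τ hτ => Eventually.of_forall fun i => ?_) (integrable_const _)
        (Eventually.of_forall fun i => (continuous_logit n a).comp_continuousOn
          (continuousOn_pi.2 fun b => hwc i b))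
      rw [Real.norm_of_nonneg ((logit_mem_stdSimplex _ _).1 a)]
      exact (mem_Icc_of_mem_stdSimplex (logit_mem_stdSimplex _ _) a).2
    · intro τ hτ
      refine ⟨fun a => integral_nonneg fun i => (logit_mem_stdSimplex _ _).1 a, ?_⟩
      rw [← integral_finsetSum _ fun a _ => integrable_coord_of_mem_stdSimplex (hlm n τ hτ)
        (fun i => logit_mem_stdSimplex _ _) a]
      simp [(logit_mem_stdSimplex _ _).2]
  choose τ hτ hτfix using hfix
  obtain ⟨σ, hσ, ns, hns, hlim⟩ := (isCompact_stdSimplex ℝ A).tendsto_subseq hτ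
  have hlim' : Tendsto (fun n => τ (ns n)) atTop (𝓝[stdSimplex ℝ A] σ) :=
    tendsto_nhdsWithin_iff.2 ⟨hlim, Eventually.of_forall fun n => hτ _⟩
  have hD := measurableSet_bestActions_fiber (v := fun i b => w i b σ) fun a => hwm a σ hσ
  obtain ⟨P, hP0, hPk, hPa, hPz⟩ := exists_limit_cell_masses lam hD
    (g := fun n i => logit (ns n) fun b => w i b (τ (ns n)))
    (fun n => hlm _ _ (hτ _)) (fun n i => logit_mem_stdSimplex _ _) (σ := σ) (fun a => by
      have h := tendsto_pi_nhds.1 hlim a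
      refine h.congr fun n => ?_
      exact (congrFun (hτfix (ns n)) a).symm)
  let m : Finset A → ℝ := fun B => lam.real ((fun i => bestActions fun b => w i b σ) ⁻¹' {B})
  let q : Finset A → A → ℝ := fun B =>
    if 0 < m B then fun a => P B a / m B
    else Pi.single (if h : B.Nonempty then h.choose else Classical.arbitrary A) 1
  have hPm : ∀ B, ∑ a, P B a = m B := hPk
  have hqΔ : ∀ B, q B ∈ stdSimplex ℝ A := by
    intro B
    by_cases h : 0 < m B
    · simp only [q, h, if_true]
      refine ⟨fun a => div_nonneg (hP0 B a) h.le, ?_⟩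
      rw [← Finset.sum_div, hPm, div_self h.ne']
    · simp only [q, h, if_false]
      exact single_mem_stdSimplex ℝ _
  refine ⟨σ, hσ, q, hqΔ, fun B hB a ha => ?_, fun a => ?_⟩
  · by_cases h : 0 < m B
    · simp only [q, h, if_true]
      rw [hPz B a, zero_div]
      rintro i rfl
      exact tendsto_logit_of_notMem_bestActions
        (tendsto_natCast_atTop_atTop.comp hns.tendsto_atTop)
        (fun b => (hwc i b σ hσ).tendsto.comp hlim') ha
    · simp only [q, h, if_false, hB, dif_pos]
      exact Pi.single_eq_of_ne (fun hac => ha (by rw [hac]; exact hB.choose_spec)) _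
  · have hqm : Measurable fun i => q (bestActions fun b => w i b σ) := by
      let _ : MeasurableSpace (Finset A) := ⊤
      exact (measurable_from_top (f := q)).comp (measurable_to_countable' hD)
    rw [integral_eq_sum_setIntegral_fiber hD
      (integrable_coord_of_mem_stdSimplex hqm (fun i => hqΔ _) a), ← hPa a]
    refine Finset.sum_congr rfl fun B _ => ?_
    rw [setIntegral_congr_fun (g := fun _ => q B a) (hD B) fun i hi => by
      simp only [Set.mem_preimage, Set.mem_singleton_iff] at hi
      simp only [hi], setIntegral_const]
    change m B * q B a = P B a
    by_cases h : 0 < m B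
    · simp only [q, h, if_true]
      field_simp
    · have h0 : m B = 0 := le_antisymm (not_lt.1 h) measureReal_nonneg
      have h1 : P B a ≤ 0 := by
        rw [← h0, ← hPm B]
        exact Finset.single_le_sum (fun b _ => hP0 B b) (Finset.mem_univ a)
      rw [h0, zero_mul, le_antisymm h1 (hP0 B a)]

open Classical in
/-- A constant profile on a set where `θ` has no atoms can be rearranged, without changing the
aggregate, so that a given action in its support is played purely; finitely many rearrangements
serve all players. -/
theorem exists_finite_pure_rearrangement_const {I A : Type*} [MeasurableSpace I] [Fintype A]
    (ν : Measure I) [IsFiniteMeasure ν] {θ : I → ℝ} (hθ : Measurable θ) {D : Set I}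
    (hatom : ∀ t, ν (D ∩ θ ⁻¹' {t}) = 0) {q : A → ℝ} (hq : q ∈ stdSimplex ℝ A)
    {a : A} (ha : 0 < q a) :
    ∃ G : Set (I → A → ℝ), G.Finite ∧
      (∀ g ∈ G, Measurable g ∧ (∀ i, g i ∈ stdSimplex ℝ A) ∧ (∀ i x, q x = 0 → g i x = 0) ∧
        ∀ x, ∫ i in D, g i x ∂ν = ν.real D * q x) ∧
      ∀ i, ∃ g ∈ G, g i = Pi.single a 1 := by
  obtain ⟨m, hm⟩ := exists_nat_one_div_lt ha
  set c : ℝ := 1 / ((m : ℝ) + 1) with hc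
  have hc0 : 0 < c := by positivity
  obtain ⟨γ, hγ, hγD⟩ := exists_measurable_partition (A := Fin (m + 2)) ν hθ hatom
    (p := fun _ => ν.real D / (m + 2)) (fun _ => by positivity) (by
      simp only [Finset.sum_const, Finset.card_univ, Fintype.card_fin, nsmul_eq_mul]
      push_cast
      field_simp)
  let e : A → ℝ := Pi.single a 1
  have he : e ∈ stdSimplex ℝ A := single_mem_stdSimplex ℝ a
  let r : A → ℝ := fun x => q x + c * (q x - e x)
  have hr : r ∈ stdSimplex ℝ A := by
    refine ⟨fun x => ?_, ?_⟩
    · by_cases hx : x = a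
      · subst hx
        simp only [r, e, Pi.single_eq_same]
        nlinarith
      · simp only [r, e, Pi.single_eq_of_ne hx]
        have := hq.1 x
        nlinarith
    · simp only [r, Finset.sum_add_distrib, ← Finset.mul_sum, Finset.sum_sub_distrib, hq.2, he.2]
      ring
  let J : Fin (m + 2) → Set I := fun j => θ ⁻¹' (γ ⁻¹' {j})
  have hJ : ∀ j, MeasurableSet (J j) := fun j => hθ (hγ (measurableSet_singleton j))
  let g : Fin (m + 2) → I → A → ℝ := fun j => (J j).piecewise (fun _ => e) fun _ => r
  refine ⟨Set.range g, Set.finite_range g, ?_, fun i => ⟨g (γ (θ i)), ⟨_, rfl⟩, ?_⟩⟩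
  · rintro _ ⟨j, rfl⟩
    refine ⟨Measurable.piecewise (hJ j) measurable_const measurable_const, fun i => ?_,
      fun i x hx => ?_, fun x => ?_⟩
    · by_cases hi : i ∈ J j <;> simp [g, hi, he, hr]
    · have hxa : x ≠ a := by rintro rfl; exact ha.ne' hx
      by_cases hi : i ∈ J j <;> simp [g, hi, r, e, hx, hxa]
    · have hgx : ∀ i, g j i x = (J j).indicator (fun _ => e x - r x) i + r x := by
        intro i
        by_cases hi : i ∈ J j <;> simp [g, hi]
      simp only [hgx]
      rw [integral_add ((integrable_const _).indicator (hJ j)) (integrable_const _),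
        integral_indicator (hJ j), setIntegral_const, setIntegral_const,
        measureReal_restrict_apply (hJ j), Set.inter_comm, hγD j]
      simp only [r, smul_eq_mul, hc]
      field_simp
      ring
  · have hi : i ∈ J (γ (θ i)) := rfl
    simp [g, hi, e]

open Classical in
theorem exists_finite_pure_rearrangement {I A κ : Type*} [MeasurableSpace I] [Fintype A]
    [Fintype κ] (ν : Measure I) [IsFiniteMeasure ν] {θ : I → ℝ} (hθ : Measurable θ) {N : Set I}
    (hN : MeasurableSet N) (hatom : ∀ t, ν (N ∩ θ ⁻¹' {t}) = 0) {B : I → κ}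
    (hB : ∀ b, MeasurableSet (B ⁻¹' {b})) {q : κ → A → ℝ} (hq : ∀ b, q b ∈ stdSimplex ℝ A) :
    ∃ G : Set (I → A → ℝ), G.Finite ∧ G.Nonempty ∧
      (∀ g ∈ G, Measurable g ∧ (∀ i, g i ∈ stdSimplex ℝ A) ∧
        (∀ i a, q (B i) a = 0 → g i a = 0) ∧ (∀ i ∉ N, g i = q (B i)) ∧
        ∀ a, ∫ i, g i a ∂ν = ∫ i, q (B i) a ∂ν) ∧
      ∀ i ∈ N, ∀ a, 0 < q (B i) a → ∃ g ∈ G, g i = Pi.single a 1 := by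
  have hg₀ : Measurable fun i => q (B i) := by
    let _ : MeasurableSpace κ := ⊤
    exact (measurable_from_top (f := q)).comp (measurable_to_countable' hB)
  choose G hGfin hG hGpure using fun (b : κ) (a : A) (h : 0 < q b a) =>
    exists_finite_pure_rearrangement_const ν hθ (D := N ∩ B ⁻¹' {b})
      (fun t => measure_mono_null (by gcongr; exact Set.inter_subset_left) (hatom t)) (hq b) h
  have hS : ∀ b, MeasurableSet (N ∩ B ⁻¹' {b}) := fun b => hN.inter (hB b)
  refine ⟨insert (fun i => q (B i)) (⋃ b, ⋃ a, ⋃ h : 0 < q b a,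
    (fun g => (N ∩ B ⁻¹' {b}).piecewise g fun i => q (B i)) '' G b a h), ?_,
    Set.insert_nonempty _ _, ?_, ?_⟩
  · exact (Set.finite_iUnion fun b => Set.finite_iUnion fun a => Set.finite_iUnion fun h =>
      (hGfin b a h).image _).insert _
  · intro g hg
    rcases hg with rfl | hg
    · exact ⟨hg₀, fun i => hq _, fun i a h => h, fun i _ => rfl, fun a => rfl⟩
    · simp only [Set.mem_iUnion] at hg
      obtain ⟨b, a, h, g, hgG, rfl⟩ := hg
      obtain ⟨hgm, hgΔ, hgz, hgint⟩ := hG b a h g hgG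
      refine ⟨Measurable.piecewise (hS b) hgm hg₀, fun i => ?_, fun i x hx => ?_, fun i hi => ?_,
        fun x => ?_⟩
      · by_cases hi : i ∈ N ∩ B ⁻¹' {b}
        · simpa only [Set.piecewise_eq_of_mem _ _ _ hi] using hgΔ i
        · simpa only [Set.piecewise_eq_of_notMem _ _ _ hi] using hq _
      · by_cases hi : i ∈ N ∩ B ⁻¹' {b}
        · simp only [Set.piecewise_eq_of_mem _ _ _ hi]
          exact hgz i x (by rw [← hi.2]; exact hx)
        · simpa only [Set.piecewise_eq_of_notMem _ _ _ hi] using hx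
      · exact Set.piecewise_eq_of_notMem _ _ _ fun h => hi h.1
      · have hi₀ := integrable_coord_of_mem_stdSimplex (ν := ν) hg₀ (fun i => hq _) x
        have hi₁ := integrable_coord_of_mem_stdSimplex (ν := ν) hgm hgΔ x
        have hpw : (fun i => (N ∩ B ⁻¹' {b}).piecewise g (fun i => q (B i)) i x) =
            (N ∩ B ⁻¹' {b}).piecewise (fun i => g i x) fun i => q (B i) x := by
          funext i
          by_cases hi : i ∈ N ∩ B ⁻¹' {b}
          · simp only [Set.piecewise_eq_of_mem _ _ _ hi]
          · simp only [Set.piecewise_eq_of_notMem _ _ _ hi]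
        rw [hpw, integral_piecewise (hS b) hi₁.integrableOn hi₀.integrableOn, hgint,
          ← integral_add_compl (hS b) hi₀]
        congr 1
        rw [setIntegral_congr_fun (g := fun _ => q b x) (hS b) fun i hi => by
          have : B i = b := hi.2
          simp only [this], setIntegral_const, smul_eq_mul]
  · intro i hi a ha
    obtain ⟨g, hg, hgi⟩ := hGpure (B i) a ha i
    refine ⟨_, Set.mem_insert_of_mem _ (Set.mem_iUnion.2 ⟨B i, Set.mem_iUnion.2 ⟨a,
      Set.mem_iUnion.2 ⟨ha, g, hg, rfl⟩⟩⟩), ?_⟩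
    exact (Set.piecewise_eq_of_mem _ _ _ (show i ∈ N ∩ B ⁻¹' {B i} from ⟨hi, rfl⟩)).trans hgi

/-- A full-support distribution on the simplex carried by a dense sequence. -/
theorem exists_fullSupportOnSimplex (A : Type*) [Fintype A] [Nonempty A] :
    ∃ (d : ℕ → A → ℝ) (ρ : Measure ℕ), IsProbabilityMeasure ρ ∧ (∀ k, d k ∈ stdSimplex ℝ A) ∧
      stdSimplex ℝ A ⊆ closure (Set.range d) ∧ FullSupportOnSimplex (ρ.map d) := by
  let d' := TopologicalSpace.denseSeq (stdSimplex ℝ A)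
  have hd' : DenseRange d' := TopologicalSpace.denseRange_denseSeq _
  let d : ℕ → A → ℝ := fun k => d' k
  have hd : Measurable d := measurable_from_nat
  have hU : ∀ U : Set (A → ℝ), IsOpen U → (U ∩ stdSimplex ℝ A).Nonempty → ∃ k, d k ∈ U := by
    rintro U hU ⟨x, hxU, hx⟩
    exact hd'.exists_mem_open (hU.preimage continuous_subtype_val) ⟨⟨x, hx⟩, hxU⟩
  have hρ : ∀ k : ℕ, (Measure.count : Measure ℕ).toFinite {k} ≠ 0 := fun k h => by
    have := absolutelyContinuous_toFinite (Measure.count : Measure ℕ) h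
    simp at this
  have hne : NeZero (Measure.count : Measure ℕ) := ⟨fun h => by
    have := Measure.count_singleton (0 : ℕ)
    simp [h] at this⟩
  refine ⟨d, (Measure.count : Measure ℕ).toFinite, inferInstance, fun k => (d' k).2,
    fun x hx => mem_closure_iff.2 fun U hUo hxU => ?_,
    Measure.isProbabilityMeasure_map hd.aemeasurable, ?_, fun U hUo hUne => ?_⟩
  · obtain ⟨k, hk⟩ := hU U hUo ⟨x, hxU, hx⟩
    exact ⟨d k, hk, k, rfl⟩
  · rw [Measure.map_apply hd (isClosed_stdSimplex ℝ A).measurableSet.compl]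
    rw [Set.eq_empty_of_forall_notMem fun k (hk : k ∈ d ⁻¹' (stdSimplex ℝ A)ᶜ) =>
       hk (d' k).2, measure_empty]
  · obtain ⟨k, hk⟩ := hU U hUo hUne
    rw [Measure.map_apply hd hUo.measurableSet]
    exact (pos_iff_ne_zero.2 (hρ k)).trans_le (measure_mono (by simpa using hk))

theorem FullSupportOnSimplex.integrable {A : Type*} [Fintype A] {η : Measure (A → ℝ)}
    (hη : FullSupportOnSimplex η) {f : (A → ℝ) → ℝ} (hf : ContinuousOn f (stdSimplex ℝ A)) :
    Integrable f η := by
  have := hη.1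
  have hr : η.restrict (stdSimplex ℝ A) = η :=
    Measure.restrict_eq_self_of_ae_mem (measure_eq_zero_iff_ae_notMem.1 hη.2.1 |>.mono (by simp))
  have h : IntegrableOn f (stdSimplex ℝ A) η :=
    hf.integrableOn_compact (isCompact_stdSimplex ℝ A)
  rwa [IntegrableOn, hr] at h

/-- The belief `τ` contaminated by `η` with weight `ε`. -/
noncomputable def contaminate {A : Type*} (ε : ℝ) (η : Measure (A → ℝ)) (τ : A → ℝ) :
    Measure (A → ℝ) :=
  ENNReal.ofReal (1 - ε) • Measure.dirac τ + ENNReal.ofReal ε • η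

theorem integral_contaminate {A : Type*} [Fintype A] {η : Measure (A → ℝ)}
    (hη : FullSupportOnSimplex η) {ε : ℝ} (hε0 : 0 < ε) (hε1 : ε < 1) {f : (A → ℝ) → ℝ}
    (hf : ContinuousOn f (stdSimplex ℝ A)) (τ : A → ℝ) :
    ∫ x, f x ∂(contaminate ε η τ) = (1 - ε) * f τ + ε * ∫ x, f x ∂η := by
  have h1 : Integrable f (Measure.dirac τ) := integrable_dirac (by simp)
  rw [contaminate, integral_add_measure (h1.smul_measure ENNReal.ofReal_ne_top)
    ((hη.integrable hf).smul_measure ENNReal.ofReal_ne_top), integral_smul_measure,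
    integral_smul_measure, integral_dirac, ENNReal.toReal_ofReal (by linarith),
    ENNReal.toReal_ofReal hε0.le, smul_eq_mul, smul_eq_mul]

theorem le_contaminate_singleton {A : Type*} [Fintype A] (η : Measure (A → ℝ)) (ε : ℝ)
    (τ : A → ℝ) : ENNReal.ofReal (1 - ε) ≤ contaminate ε η τ {τ} := by
  simp [contaminate]

theorem isPerturbation_contaminate {A : Type*} [Fintype A] {η : Measure (A → ℝ)}
    (hη : FullSupportOnSimplex η) {ε : ℝ} (hε0 : 0 < ε) (hε1 : ε < 1) :
    IsPerturbation (contaminate ε η) := by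
  refine ⟨fun τ hτ => ⟨⟨?_⟩, ?_, fun U hU hne => ?_⟩, fun f hf => ?_⟩
  · have := hη.1
    simp only [contaminate, Measure.coe_add, Measure.coe_smul, Pi.add_apply, Pi.smul_apply,
      measure_univ, smul_eq_mul, mul_one]
    rw [← ENNReal.ofReal_add (by linarith) hε0.le]
    simp
  · simp [contaminate, hη.2.1, hτ]
  · simp only [contaminate, Measure.coe_add, Measure.coe_smul, Pi.add_apply, Pi.smul_apply,
      smul_eq_mul]
    exact (ENNReal.mul_pos (by simpa using hε0) (hη.2.2 U hU hne).ne').trans_le le_add_self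
  · simp only [integral_contaminate hη hε0 hε1 hf.continuousOn]
    exact (hf.measurable.const_mul _).add_const _

theorem measurable_payM_map {I A : Type*} [MeasurableSpace I] [Fintype A]
    {u : I → A → (A → ℝ) → ℝ} (hu : IsLargeGame u) {ρ : Measure ℕ} [SFinite ρ] {d : ℕ → A → ℝ}
    (hd : ∀ k, d k ∈ stdSimplex ℝ A) (hη : FullSupportOnSimplex (ρ.map d)) (a : A) :
    Measurable fun i => payM (u i) a (ρ.map d) := by
  have h : ∀ i, payM (u i) a (ρ.map d) = ∫ k, u i a (d k) ∂ρ := fun i =>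
    integral_map (measurable_from_nat (f := d)).aemeasurable
      (hη.integrable (hu.1 i a)).aestronglyMeasurable
  simp only [h]
  have hm : Measurable fun p : I × ℕ => u p.1 a (d p.2) :=
    measurable_from_prod_countable_left fun k => hu.2 a (d k) (hd k)
  exact hm.stronglyMeasurable.integral_prod_right.measurable

/-- Players can be labelled measurably by reals recording their payoffs on the simplex. -/
theorem IsLargeGame.exists_measurable_label {I A : Type*} [MeasurableSpace I] [Fintype A]
    {u : I → A → (A → ℝ) → ℝ} (hu : IsLargeGame u) {d : ℕ → A → ℝ}
    (hd : ∀ k, d k ∈ stdSimplex ℝ A) (hdense : stdSimplex ℝ A ⊆ closure (Set.range d)) :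
    ∃ θ : I → ℝ, Measurable θ ∧ (∀ i i', u i = u i' → θ i = θ i') ∧
      ∀ i i', θ i = θ i' → ∀ a, Set.EqOn (u i a) (u i' a) (stdSimplex ℝ A) := by
  obtain ⟨e, he⟩ := exists_measurableEmbedding_real (A → ℕ → ℝ)
  refine ⟨fun i => e fun a k => u i a (d k), he.measurable.comp (measurable_pi_lambda _ fun a =>
    measurable_pi_lambda _ fun k => hu.2 a (d k) (hd k)), fun i i' h => by simp only [h],
    fun i i' h a => ?_⟩
  have h' : ∀ k, u i a (d k) = u i' a (d k) := fun k => congrFun (congrFun (he.injective h) a) k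
  refine Set.EqOn.of_subset_closure (s := Set.range d) ?_ (hu.1 i a) (hu.1 i' a)
    (Set.range_subset_iff.2 hd) hdense
  rintro _ ⟨k, rfl⟩
  exact h' k

theorem measurable_of_eq_off_countable {E : Type*} [MeasurableSpace E] {S : Set ℝ}
    (hS : S.Countable) {f : ℝ → E} {c : E} (hf : ∀ t ∉ S, f t = c) : Measurable f := by
  have := hS.to_subtype
  refine measurable_of_restrict_of_restrict_compl hS.measurableSet .of_discrete ?_
  have h : Sᶜ.domRestrict f = fun _ => c := funext fun t => hf t t.2
  rw [h]
  exact measurable_const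

open Classical in
/-- A sequence of profiles that depend on the label through finitely many cells has, after
rearrangements and passage to a subsequence, a symmetric limit profile. -/
theorem exists_symmetric_limit_profile {I A κ : Type*} [MeasurableSpace I] [Fintype A]
    [Nonempty A] [Fintype κ] (lam : Measure I) [IsProbabilityMeasure lam] {θ : I → ℝ}
    (hθ : Measurable θ) {B : ℕ → I → κ} (hB : ∀ n b, MeasurableSet (B n ⁻¹' {b}))
    (hBθ : ∀ n i i', θ i = θ i' → B n i = B n i') {q : ℕ → κ → A → ℝ}
    (hq : ∀ n b, q n b ∈ stdSimplex ℝ A) :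
    ∃ (h : I → A → ℝ) (m : ℕ → ℕ) (g : ℕ → I → A → ℝ),
      IsProfile lam h ∧ (∀ i i', θ i = θ i' → h i = h i') ∧ Tendsto m atTop atTop ∧
      (∀ k, IsProfile lam (g k) ∧ (∀ i a, q (m k) (B (m k) i) a = 0 → g k i a = 0) ∧
        socSum lam (g k) = socSum lam fun i => q (m k) (B (m k) i)) ∧
      (∀ᵐ i ∂lam, ∃ nk : ℕ → ℕ, StrictMono nk ∧ Tendsto (fun k => g (nk k) i) atTop (𝓝 (h i))) ∧
      Tendsto (fun k => socSum lam (g k)) atTop (𝓝 (socSum lam h)) := by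
  have hgm : ∀ n, Measurable fun i => q n (B n i) := fun n => by
    let _ : MeasurableSpace κ := ⊤
    exact (measurable_from_top (f := q n)).comp (measurable_to_countable' (hB n))
  have hσΔ : ∀ n, socSum lam (fun i => q n (B n i)) ∈ stdSimplex ℝ A := by
    intro n
    refine ⟨fun a => integral_nonneg fun i => (hq n _).1 a, ?_⟩
    simp only [socSum]
    rw [← integral_finsetSum _ fun a _ => integrable_coord_of_mem_stdSimplex (hgm n)
      (fun i => hq n _) a]
    simp [(hq n _).2]
  -- the atoms of the label
  let S : Set ℝ := {t | 0 < lam {i | θ i = t}}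
  have hS : S.Countable := Measure.countable_meas_level_set_pos hθ
  have hScount := hS.to_subtype
  let N : Set I := θ ⁻¹' Sᶜ
  have hN : MeasurableSet N := hθ hS.measurableSet.compl
  have hatom : ∀ t, lam (N ∩ θ ⁻¹' {t}) = 0 := by
    intro t
    by_cases ht : t ∈ S
    · rw [show N ∩ θ ⁻¹' {t} = ∅ from Set.eq_empty_of_forall_notMem
        fun i hi => hi.1 (by rw [hi.2]; exact ht), measure_empty]
    · exact measure_mono_null Set.inter_subset_right (nonpos_iff_eq_zero.1 (not_lt.1 ht))
  have hrep : ∀ t : S, ∃ i, θ i = t := fun t => nonempty_of_measure_ne_zero (ne_of_gt t.2)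
  choose rep hrep using hrep
  obtain ⟨σ, -, ns₁, hns₁, hσ₁⟩ := (isCompact_stdSimplex ℝ A).tendsto_subseq hσΔ
  obtain ⟨L, hLΔ, ns₂, hns₂, hL⟩ :=
    (isCompact_univ_pi fun _ : S => isCompact_stdSimplex ℝ A).tendsto_subseq
      (x := fun n t => q (ns₁ n) (B (ns₁ n) (rep t))) (fun n t _ => hq _ _)
  let ns : ℕ → ℕ := ns₁ ∘ ns₂
  have hns : StrictMono ns := hns₁.comp hns₂
  have hσ : Tendsto (fun n => socSum lam fun i => q (ns n) (B (ns n) i)) atTop (𝓝 σ) :=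
    hσ₁.comp hns₂.tendsto_atTop
  let a₀ : A := Classical.arbitrary A
  let L' : ℝ → A → ℝ := fun t => if ht : t ∈ S then L ⟨t, ht⟩ else Pi.single a₀ 1
  have hL'm : Measurable L' := measurable_of_eq_off_countable hS fun t ht => dif_neg ht
  have hL'Δ : ∀ t, L' t ∈ stdSimplex ℝ A := by
    intro t
    by_cases ht : t ∈ S
    · simp only [L', ht, dif_pos]; exact hLΔ _ trivial
    · simp only [L', ht, dif_neg, not_false_iff]; exact single_mem_stdSimplex ℝ a₀
  have hlim : ∀ i ∉ N, Tendsto (fun n => q (ns n) (B (ns n) i)) atTop (𝓝 (L' (θ i))) := by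
    intro i hi
    have ht : θ i ∈ S := not_not.1 hi
    have h1 := tendsto_pi_nhds.1 hL ⟨θ i, ht⟩
    simp only [L', ht, dif_pos]
    refine h1.congr fun n => ?_
    simp only [Function.comp, ns]
    rw [hBθ _ _ _ (hrep ⟨θ i, ht⟩)]
  -- the limit on the atomless part
  have hcoord : ∀ n a, Integrable (fun i => q n (B n i) a) lam := fun n a =>
    integrable_coord_of_mem_stdSimplex (hgm n) (fun i => hq n _) a
  have hdct : ∀ a, Tendsto (fun n => ∫ i in Nᶜ, q (ns n) (B (ns n) i) a ∂lam) atTop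
      (𝓝 (∫ i in Nᶜ, L' (θ i) a ∂lam)) := by
    intro a
    refine tendsto_integral_of_dominated_convergence (fun _ => (1 : ℝ))
      (fun n => (hcoord _ a).aestronglyMeasurable.restrict) (integrable_const _) (fun n => ?_) ?_
    · refine Eventually.of_forall fun i => ?_
      rw [Real.norm_of_nonneg ((hq _ _).1 a)]
      exact (mem_Icc_of_mem_stdSimplex (hq _ _) a).2
    · filter_upwards [ae_restrict_mem hN.compl] with i hi
      exact tendsto_pi_nhds.1 (hlim i hi) a
  obtain ⟨f, hfm, hfσ, hffreq, hfsym⟩ := exists_pure_limit_selection (lam.restrict N) hθ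
    (fun t => by
      rw [Measure.restrict_apply (hθ (measurableSet_singleton t)), Set.inter_comm]
      exact hatom t)
    (g := fun n i => q (ns n) (B (ns n) i)) (fun n => hgm _) (fun n i => hq _ _)
    (σ := fun a => σ a - ∫ i in Nᶜ, L' (θ i) a ∂lam) (fun a => by
      refine ((tendsto_pi_nhds.1 hσ a).sub (hdct a)).congr fun n => ?_
      simp only [socSum]
      rw [← integral_add_compl hN (hcoord (ns n) a)]
      ring)
  let e : I → A → ℝ := fun i => Pi.single (f i) 1
  have he : Measurable e := by
    let _ : MeasurableSpace A := ⊤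
    exact (measurable_from_top (f := fun a : A => (Pi.single a 1 : A → ℝ))).comp
      (measurable_to_countable' hfm)
  have heΔ : ∀ i, e i ∈ stdSimplex ℝ A := fun i => single_mem_stdSimplex ℝ _
  let h : I → A → ℝ := N.piecewise e fun i => L' (θ i)
  have hhN : ∀ i ∈ N, h i = e i := fun i hi => Set.piecewise_eq_of_mem _ _ _ hi
  have hhN' : ∀ i ∉ N, h i = L' (θ i) := fun i hi => Set.piecewise_eq_of_notMem _ _ _ hi
  have hh : IsProfile lam h := by
    refine ⟨Measurable.piecewise hN he (hL'm.comp hθ), fun i => ?_⟩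
    by_cases hi : i ∈ N
    · rw [hhN i hi]; exact heΔ i
    · rw [hhN' i hi]; exact hL'Δ _
  have hhσ : socSum lam h = σ := by
    funext a
    simp only [socSum]
    rw [← integral_add_compl hN (integrable_coord_of_mem_stdSimplex hh.1 hh.2 a),
      setIntegral_congr_fun hN fun i hi => congrFun (hhN i hi) a,
      setIntegral_congr_fun hN.compl fun i hi => congrFun (hhN' i hi) a]
    have h1 : ∀ i, e i a = (f ⁻¹' {a}).indicator (1 : I → ℝ) i := by
      intro i
      by_cases hi : f i = a
      · subst hi; simp [e]
      · simp [e, hi, Ne.symm hi]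
    simp only [h1]
    rw [integral_indicator_one (hfm a), hfσ]
    ring
  -- the rearranged sequence
  choose G hGfin hGne hG hGpure using fun n =>
    exists_finite_pure_rearrangement lam hθ hN hatom (hB (ns n)) (hq (ns n))
  have hGfin' : ∀ n, Finite (G n) := fun n => (hGfin n).to_subtype
  have hGne' : ∀ n, Nonempty (G n) := fun n => (hGne n).to_subtype
  have hinf : Infinite (Σ n, G n) := Infinite.of_surjective (fun x : Σ n, G n => x.1)
    fun n => ⟨⟨n, (hGne' n).some⟩, rfl⟩
  obtain ⟨hden⟩ := nonempty_denumerable (Σ n, G n)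
  let E : ℕ ≃ Σ n, G n := (Denumerable.eqv _).symm
  have hfst : Tendsto (fun k => (E k).1) atTop atTop := by
    have h1 : Tendsto (fun x : Σ n, G n => x.1) cofinite cofinite :=
      Tendsto.cofinite_of_finite_preimage_singleton fun n =>
        (Set.finite_range fun y : G n => (⟨n, y⟩ : Σ n, G n)).subset (by
          rintro ⟨_, y⟩ rfl
          exact ⟨y, rfl⟩)
    rw [← Nat.cofinite_eq_atTop]
    exact h1.comp E.injective.tendsto_cofinite
  have hsum : ∀ k, socSum lam ((E k).2 : I → A → ℝ) =
      socSum lam fun i => q (ns (E k).1) (B (ns (E k).1) i) := fun k =>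
    funext (hG _ _ (E k).2.2).2.2.2.2
  refine ⟨h, fun k => ns (E k).1, fun k => (E k).2, hh, fun i i' hi => ?_,
    hns.tendsto_atTop.comp hfst, fun k => ?_, ?_, ?_⟩
  · by_cases hiN : i ∈ N
    · have hiN' : i' ∈ N := by simpa only [N, Set.mem_preimage, hi] using hiN
      rw [hhN i hiN, hhN i' hiN']
      simp only [e, hfsym i i' hi fun n => by rw [hBθ _ i i' hi]]
    · have hiN' : i' ∉ N := by simpa only [N, Set.mem_preimage, hi] using hiN
      rw [hhN' i hiN, hhN' i' hiN', hi]
  · obtain ⟨h1, h2, h3, -, -⟩ := hG _ _ (E k).2.2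
    exact ⟨⟨h1, h2⟩, h3, hsum k⟩
  · filter_upwards [(ae_restrict_iff' hN).1 hffreq] with i hi
    by_cases hiN : i ∈ N
    · have hfreq : ∃ᶠ k in atTop, ((E k).2 : I → A → ℝ) i = h i := by
        rw [Nat.frequently_atTop_iff_infinite]
        refine Set.Infinite.of_image (fun k => (E k).1)
          ((Nat.frequently_atTop_iff_infinite.1 (hi hiN)).mono fun n hn => ?_)
        obtain ⟨g, hg, hgi⟩ := hGpure n i hiN (f i) hn
        refine ⟨E.symm ⟨n, g, hg⟩, ?_, ?_⟩
        · change ((E (E.symm ⟨n, g, hg⟩)).2 : I → A → ℝ) i = h i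
          rw [E.apply_symm_apply, hhN i hiN]
          exact hgi
        · simp
      obtain ⟨nk, hnk, hnkP⟩ := extraction_of_frequently_atTop hfreq
      exact ⟨nk, hnk, by simp only [hnkP]; exact tendsto_const_nhds⟩
    · refine ⟨id, strictMono_id, ?_⟩
      rw [hhN' i hiN]
      refine ((hlim i hiN).comp hfst).congr fun k => ?_
      exact ((hG _ _ (E k).2.2).2.2.2.1 i hiN).symm
  · rw [hhσ]
    simp only [hsum]
    exact hσ.comp hfst

/-- The mixed action `τ` trembling uniformly with probability `ε`. -/
noncomputable def tremble {A : Type*} [Fintype A] (ε : ℝ) (τ : A → ℝ) : A → ℝ :=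
  fun a => (1 - ε) * τ a + ε / Fintype.card A

theorem continuous_tremble {A : Type*} [Fintype A] (ε : ℝ) :
    Continuous (tremble ε : (A → ℝ) → A → ℝ) := by
  unfold tremble
  fun_prop

theorem tremble_mem_stdSimplex {A : Type*} [Fintype A] [Nonempty A] {ε : ℝ} (hε0 : 0 ≤ ε)
    (hε1 : ε ≤ 1) {τ : A → ℝ} (hτ : τ ∈ stdSimplex ℝ A) : tremble ε τ ∈ stdSimplex ℝ A := by
  refine ⟨fun a => add_nonneg (mul_nonneg (by linarith) (hτ.1 a)) (by positivity), ?_⟩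
  simp only [tremble, Finset.sum_add_distrib, ← Finset.mul_sum, hτ.2, Finset.sum_const,
    Finset.card_univ, nsmul_eq_mul]
  field_simp
  ring

theorem tremble_pos {A : Type*} [Fintype A] [Nonempty A] {ε : ℝ} (hε0 : 0 < ε)
    (hε1 : ε ≤ 1) {τ : A → ℝ} (hτ : τ ∈ stdSimplex ℝ A) (a : A) : 0 < tremble ε τ a :=
  add_pos_of_nonneg_of_pos (mul_nonneg (by linarith) (hτ.1 a)) (by positivity)

theorem tremble_le_of_eq_zero {A : Type*} [Fintype A] [Nonempty A] {ε : ℝ} (hε0 : 0 ≤ ε)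
    {τ : A → ℝ} {a : A} (ha : τ a = 0) : tremble ε τ a ≤ ε := by
  simp only [tremble, ha, mul_zero, zero_add]
  exact div_le_self hε0 (by exact_mod_cast Fintype.card_pos)

theorem tendsto_tremble {A : Type*} [Fintype A] {ε : ℕ → ℝ} (hε : Tendsto ε atTop (𝓝 0))
    {τ : ℕ → A → ℝ} {τ' : A → ℝ} (hτ : Tendsto τ atTop (𝓝 τ')) :
    Tendsto (fun n => tremble (ε n) (τ n)) atTop (𝓝 τ') := by
  refine tendsto_pi_nhds.2 fun a => ?_
  simpa [tremble] using ((hε.const_sub 1).mul (tendsto_pi_nhds.1 hτ a)).add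
    (hε.div_const (Fintype.card A : ℝ))

theorem socSum_tremble {I A : Type*} [MeasurableSpace I] [Fintype A] (lam : Measure I)
    [IsProbabilityMeasure lam] (ε : ℝ) {g : I → A → ℝ} (hg : IsProfile lam g) :
    socSum lam (fun i => tremble ε (g i)) = tremble ε (socSum lam g) := by
  funext a
  simp only [socSum, tremble]
  rw [integral_add ((integrable_coord_of_mem_stdSimplex hg.1 hg.2 a).const_mul _)
    (integrable_const _), integral_const_mul]
  simp

theorem IsProfile.tremble {I A : Type*} [MeasurableSpace I] [Fintype A] [Nonempty A]
    {lam : Measure I} {g : I → A → ℝ} (hg : IsProfile lam g) {ε : ℝ} (hε0 : 0 ≤ ε)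
    (hε1 : ε ≤ 1) : IsProfile lam fun i => _root_.tremble ε (g i) :=
  ⟨(continuous_tremble ε).measurable.comp hg.1, fun i => tremble_mem_stdSimplex hε0 hε1 (hg.2 i)⟩

theorem isEpsRPE_tremble {I A : Type*} [MeasurableSpace I] [Fintype A] [Nonempty A]
    (lam : Measure I) [IsProbabilityMeasure lam] {u : I → A → (A → ℝ) → ℝ}
    {η : Measure (A → ℝ)} (hη : FullSupportOnSimplex η) {ε : ℝ} (hε0 : 0 < ε) (hε1 : ε < 1)
    {g : I → A → ℝ} (hg : IsProfile lam g)
    (hbest : ∀ i, ∀ a ∉ bestActions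
      (fun b => payM (u i) b (contaminate ε η (tremble ε (socSum lam g)))), g i a = 0) :
    IsEpsRPE lam u ε (fun i => tremble ε (g i)) Set.univ (contaminate ε η) := by
  refine ⟨hg.tremble hε0.le hε1.le,
    Eventually.of_forall fun i a => tremble_pos hε0 hε1.le (hg.2 i) a,
    MeasurableSet.univ, ?_, isPerturbation_contaminate hη hε0 hε1,
    fun τ _ => le_contaminate_singleton η ε τ, fun i _ am al hlt => ?_⟩
  · rw [measure_univ, ENNReal.ofReal_lt_one]
    linarith
  · rw [socSum_tremble lam ε hg] at hlt
    exact tremble_le_of_eq_zero hε0.le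
      (hbest i am fun hmem => (mem_bestActions.1 hmem al).not_gt hlt)

/-- Every large game possesses a symmetric randomized strategy
robust perfect equilibrium: a robust perfect equilibrium `h` with `h i = h i'`
whenever `u i = u i'`. -/
theorem statement0 {I : Type*} [MeasurableSpace I] {A : Type*} [Fintype A] [Nonempty A]
    (lam : Measure I) [IsProbabilityMeasure lam] (hatomless : MeasAtomless lam)
    (u : I → A → (A → ℝ) → ℝ) (hu : IsLargeGame u) :
    ∃ h : I → A → ℝ, IsRPE lam u h ∧ ∀ i i' : I, u i = u i' → h i = h i' := by
  obtain ⟨d, ρ, hρ, hd, hdense, hη⟩ := exists_fullSupportOnSimplex A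
  obtain ⟨θ, hθ, hθu, huθ⟩ := hu.exists_measurable_label hd hdense
  let ε : ℕ → ℝ := fun n => 1 / ((n + 1 : ℕ) + 1 : ℝ)
  have hε0 : ∀ n, 0 < ε n := fun n => by positivity
  have hε1 : ∀ n, ε n < 1 := fun n => by
    rw [div_lt_one (by positivity)]
    push_cast
    linarith [(Nat.cast_nonneg n : (0 : ℝ) ≤ n)]
  have hεlim : Tendsto ε atTop (𝓝 0) :=
    tendsto_one_div_add_atTop_nhds_zero_nat.comp (tendsto_add_atTop_nat 1)
  let w : ℕ → I → A → (A → ℝ) → ℝ := fun n i a τ =>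
    payM (u i) a (contaminate (ε n) (ρ.map d) (tremble (ε n) τ))
  have hw : ∀ n i a τ, w n i a τ = (1 - ε n) * u i a (tremble (ε n) τ) +
      ε n * payM (u i) a (ρ.map d) := fun n i a τ =>
    integral_contaminate hη (hε0 n) (hε1 n) (hu.1 i a) _
  have hmaps : ∀ n, Set.MapsTo (tremble (ε n)) (stdSimplex ℝ A) (stdSimplex ℝ A) := fun n τ hτ =>
    tremble_mem_stdSimplex (hε0 n).le (hε1 n).le hτ
  have hwm : ∀ n a, ∀ τ ∈ stdSimplex ℝ A, Measurable fun i => w n i a τ := by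
    intro n a τ hτ
    simp only [hw]
    exact ((hu.2 a _ (hmaps n hτ)).const_mul _).add ((measurable_payM_map hu hd hη a).const_mul _)
  have hwc : ∀ n i a, ContinuousOn (w n i a) (stdSimplex ℝ A) := by
    intro n i a
    rw [show w n i a = fun τ => _ from funext (hw n i a)]
    exact (((hu.1 i a).comp (continuous_tremble _).continuousOn (hmaps n)).const_smul
      (1 - ε n)).add continuousOn_const
  choose σ hσ q hq hqbest hqσ using fun n => exists_aggregate_equilibrium lam (hwc n) (hwm n)
  have hpay : ∀ i i', θ i = θ i' → ∀ a, payM (u i) a (ρ.map d) = payM (u i') a (ρ.map d) := by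
    intro i i' h a
    exact integral_congr_ae
      ((measure_eq_zero_iff_ae_notMem.1 hη.2.1).mono fun τ hτ => huθ i i' h a (not_not.1 hτ))
  obtain ⟨h, m, g, hh, hsym, hm, hg, hae, hsoc⟩ := exists_symmetric_limit_profile lam hθ
    (B := fun n i => bestActions fun b => w n i b (σ n))
    (fun n => measurableSet_bestActions_fiber fun a => hwm n a _ (hσ n))
    (fun n i i' hi => by
      have hwi : ∀ b, w n i b (σ n) = w n i' b (σ n) := fun b => by
        rw [hw, hw, huθ i i' hi b (hmaps n (hσ n)), hpay i i' hi]
      simp only [hwi]) hq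
  have hσg : ∀ k, socSum lam (g k) = σ (m k) := fun k => (hg k).2.2.trans (funext (hqσ (m k)))
  refine ⟨h, ⟨hh, fun k => ε (m k), fun k i => tremble (ε (m k)) (g k i), fun _ => Set.univ,
    fun k => contaminate (ε (m k)) (ρ.map d), fun k => hε0 _, hεlim.comp hm, fun k => ?_, ?_, ?_⟩,
    fun i i' hi => hsym i i' (hθu i i' hi)⟩
  · refine isEpsRPE_tremble lam hη (hε0 _) (hε1 _) (hg k).1 fun i a ha => (hg k).2.1 i a ?_
    rw [hσg] at ha
    exact hqbest _ _ (bestActions_nonempty _) a ha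
  · filter_upwards [hae] with i ⟨nk, hnk, hlim⟩
    exact ⟨nk, hnk, fun k => trivial,
      tendsto_tremble (hεlim.comp (hm.comp hnk.tendsto_atTop)) hlim⟩
  · simp only [socSum_tremble lam _ (hg _).1]
    exact tendsto_tremble (hεlim.comp hm) hsoc
end

section
/- Every large game possesses a pure strategy robust perfect equilibrium; that is, there exists a measurable f : I → A such that the Dirac randomized strategy profile i ↦ δ_{f(i)} is a randomized strategy robust perfect equilibrium. -/
open MeasureTheory Filter Topology

/-- Integrating a polynomial with continuous coefficients over a compact set gives a polynomial. -/
theorem exists_polynomial_eval_eq_setIntegral {E : Type*} [TopologicalSpace E] [T2Space E]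
    [MeasurableSpace E] [BorelSpace E] (μ : Measure E) [IsFiniteMeasureOnCompacts μ]
    {K : Set E} (hK : IsCompact K) (Q : Polynomial C(E, ℝ)) :
    ∃ P : Polynomial ℝ, ∀ t : ℝ,
      ∫ x in K, Q.eval₂ (ContinuousMap.evalAlgHom ℝ ℝ x : C(E, ℝ) →+* ℝ) t ∂μ = P.eval t := by
  refine ⟨∑ k ∈ Finset.range (Q.natDegree + 1),
    Polynomial.C (∫ x in K, Q.coeff k x ∂μ) * Polynomial.X ^ k, fun t => ?_⟩
  simp only [Polynomial.eval₂_eq_sum_range, Polynomial.eval_finsetSum, Polynomial.eval_mul,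
    Polynomial.eval_C, Polynomial.eval_pow, Polynomial.eval_X]
  rw [integral_finsetSum]
  · refine Finset.sum_congr rfl fun k _ => ?_
    rw [← integral_mul_const]
    rfl
  · intro k _
    have : IntegrableOn (fun x => Q.coeff k x) K μ :=
      (Q.coeff k).continuous.continuousOn.integrableOn_compact hK
    exact this.mul_const _

section Brouwer

variable {ι : Type*} [Fintype ι]

/-- For small `t`, the map `x ↦ x + t g(x)` permutes every ball containing the support of `g`, so
the change of variables formula holds on that ball. -/
theorem exists_forall_lt_setIntegral_perturb_eq {g : (ι → ℝ) → ι → ℝ}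
    (hg : ContDiff ℝ 1 g)
    (hgs : HasCompactSupport g) {B : Set (ι → ℝ)} (hB : MeasurableSet B)
    (hgB : ∀ x, x ∉ B → g x = 0) :
    ∃ δ > 0, ∀ t : ℝ, 0 ≤ t → t < δ → ∀ ρ : (ι → ℝ) → ℝ,
      ∫ x in B, ρ (x + t • g x) * (ContinuousLinearMap.id ℝ (ι → ℝ) + t • fderiv ℝ g x).det
        = ∫ x in B, ρ x := by
  obtain ⟨C, hC⟩ := ContDiff.lipschitzWith_of_hasCompactSupport hgs hg (by simp)
  have hdet : ∀ᶠ T in 𝓝 (ContinuousLinearMap.id ℝ (ι → ℝ)), 0 < T.det := by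
    apply (ContinuousLinearMap.continuous_det.tendsto _).eventually
    apply lt_mem_nhds
    simp [ContinuousLinearMap.det]
  obtain ⟨r, hr, hball⟩ := Metric.eventually_nhds_iff.mp hdet
  refine ⟨min (1 / (C + 1)) (r / (C + 1)), by positivity, fun t ht0 ht ρ => ?_⟩
  have hC1 : (0 : ℝ) < C + 1 := by positivity
  have ht1 : t * (C + 1) < 1 := by
    rw [← lt_div_iff₀ hC1]; exact ht.trans_le (min_le_left _ _)
  have ht2 : t * (C + 1) < r := by
    rw [← lt_div_iff₀ hC1]; exact ht.trans_le (min_le_right _ _)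
  have happ : ApproximatesLinearOn (fun x => x + t • g x)
      ((ContinuousLinearEquiv.refl ℝ (ι → ℝ)) : (ι → ℝ) →L[ℝ] (ι → ℝ)) Set.univ
      (t.toNNReal * C) := by
    intro x _ y _
    have h1 := hC.dist_le_mul x y
    rw [dist_eq_norm, dist_eq_norm] at h1
    have h2 : x + t • g x - (y + t • g y) -
        ((ContinuousLinearEquiv.refl ℝ (ι → ℝ)) : (ι → ℝ) →L[ℝ] (ι → ℝ)) (x - y)
        = t • (g x - g y) := by
      simp [smul_sub]; abel
    rw [h2, norm_smul, Real.norm_of_nonneg ht0, NNReal.coe_mul, Real.coe_toNNReal _ ht0, mul_assoc]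
    gcongr
  have hc : Subsingleton (ι → ℝ) ∨ t.toNNReal * C <
      ‖(((ContinuousLinearEquiv.refl ℝ (ι → ℝ)).symm : (ι → ℝ) ≃L[ℝ] (ι → ℝ)) :
        (ι → ℝ) →L[ℝ] (ι → ℝ))‖₊⁻¹ := by
    rcases subsingleton_or_nontrivial (ι → ℝ) with h | h
    · exact Or.inl h
    · right
      have : ‖(((ContinuousLinearEquiv.refl ℝ (ι → ℝ)).symm : (ι → ℝ) ≃L[ℝ] (ι → ℝ)) :
        (ι → ℝ) →L[ℝ] (ι → ℝ))‖₊ = 1 := by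
        ext
        exact ContinuousLinearMap.norm_id
      rw [this, inv_one, ← NNReal.coe_lt_coe, NNReal.coe_mul, Real.coe_toNNReal _ ht0]
      push_cast
      nlinarith
  have hinj := Set.injOn_univ.mp (happ.injOn hc)
  have hsurj := happ.surjective hc
  have himg : (fun x => x + t • g x) '' B = B := by
    apply Set.Subset.antisymm
    · rintro _ ⟨x, hx, rfl⟩
      by_contra hy
      have h0 := hgB _ hy
      have : x = x + t • g x := hinj (by simp [h0])
      change x + t • g x ∉ B at hy
      rw [← this] at hy
      exact hy hx
    · intro y hy
      obtain ⟨x, rfl⟩ := hsurj y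
      by_cases hx : x ∈ B
      · exact ⟨x, hx, rfl⟩
      · simp [hgB x hx] at hy
        exact absurd hy hx
  have hder : ∀ x ∈ B, HasFDerivWithinAt (fun x => x + t • g x)
      (ContinuousLinearMap.id ℝ (ι → ℝ) + t • fderiv ℝ g x) B x := fun x _ =>
    ((hasFDerivAt_id x).add (((hg.differentiable (by simp)) x).hasFDerivAt.const_smul
      t)).hasFDerivWithinAt
  have key := integral_image_eq_integral_abs_det_fderiv_smul volume hB hder hinj.injOn ρ
  rw [himg] at key
  rw [key]
  congr 1
  ext x
  have hpos : 0 < (ContinuousLinearMap.id ℝ (ι → ℝ) + t • fderiv ℝ g x).det := by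
    apply hball
    rw [dist_eq_norm, add_sub_cancel_left, norm_smul, Real.norm_of_nonneg ht0]
    have := norm_fderiv_le_of_lipschitz ℝ hC (x₀ := x)
    nlinarith
  rw [abs_of_pos hpos, smul_eq_mul, mul_comm]

/-- The change of variables formula for powers of `M - |x|²` and a compactly supported `C¹`
perturbation of the identity, without any smallness of the perturbation. -/
theorem setIntegral_pow_perturb_eq [DecidableEq ι] {g : (ι → ℝ) → ι → ℝ} (hg : ContDiff ℝ 1 g)
    (hgs : HasCompactSupport g) {B : Set (ι → ℝ)} (hB : IsCompact B)
    (hgB : ∀ x, x ∉ B → g x = 0) (M : ℝ) (N : ℕ) :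
    ∫ x in B, (M - ∑ i, (x i + g x i) ^ 2) ^ N *
        (ContinuousLinearMap.id ℝ (ι → ℝ) + fderiv ℝ g x).det
      = ∫ x in B, (M - ∑ i, (x i) ^ 2) ^ N := by
  obtain ⟨δ, hδ, h⟩ := exists_forall_lt_setIntegral_perturb_eq hg hgs hB.measurableSet hgB
  let cx : ι → C((ι → ℝ), ℝ) := fun i => ⟨fun x => x i, continuous_apply i⟩
  let cg : ι → C((ι → ℝ), ℝ) := fun i =>
    ⟨fun x => g x i, (continuous_apply i).comp hg.continuous⟩
  let cd : ι → ι → C((ι → ℝ), ℝ) := fun i j =>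
    ⟨fun x => fderiv ℝ g x (Pi.single j 1) i,
      (continuous_apply i).comp ((hg.continuous_fderiv (by simp)).clm_apply continuous_const)⟩
  let Q : Polynomial C((ι → ℝ), ℝ) :=
    (Polynomial.C (ContinuousMap.const _ M) -
      ∑ i, (Polynomial.C (cx i) + Polynomial.X * Polynomial.C (cg i)) ^ 2) ^ N *
    (Matrix.of fun i j => (if i = j then 1 else 0) + Polynomial.X * Polynomial.C (cd i j)).det
  obtain ⟨P, hP⟩ := exists_polynomial_eval_eq_setIntegral volume hB Q
  have hQ : ∀ t x, Q.eval₂ (ContinuousMap.evalAlgHom ℝ ℝ x : C((ι → ℝ), ℝ) →+* ℝ) t =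
      (M - ∑ i, ((x + t • g x) i) ^ 2) ^ N *
        (ContinuousLinearMap.id ℝ (ι → ℝ) + t • fderiv ℝ g x).det := by
    intro t x
    rw [← Polynomial.coe_eval₂RingHom]
    simp only [Q, map_mul, map_pow, map_sub, map_sum, map_add, RingHom.map_det]
    congr 1
    · simp [cx, cg]
    · rw [ContinuousLinearMap.det, ← LinearMap.det_toMatrix']
      congr 1
      ext i j
      simp [LinearMap.toMatrix'_apply, cd, apply_ite, Pi.single_apply]
      ring
  simp only [hQ] at hP
  have hconst : P = Polynomial.C (∫ x in B, (M - ∑ i, (x i) ^ 2) ^ N) := by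
    apply Polynomial.eq_of_infinite_eval_eq
    refine (Set.Ioo_infinite hδ).mono fun t ht => ?_
    simp only [Set.mem_ofPred_eq, Polynomial.eval_C]
    rw [← hP t]
    exact h t ht.1.le ht.2 (fun y => (M - ∑ i, (y i) ^ 2) ^ N)
  have := hP 1
  rw [hconst, Polynomial.eval_C] at this
  simpa using this

/-- A compactly supported `C¹` perturbation of the identity attains the value `0`. -/
theorem exists_add_eq_zero_of_hasCompactSupport {g : (ι → ℝ) → ι → ℝ} (hg : ContDiff ℝ 1 g)
    (hgs : HasCompactSupport g) : ∃ x, x + g x = 0 := by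
  classical
  by_contra! hne
  obtain ⟨R, hR⟩ := hgs.isCompact.isBounded.subset_closedBall 0
  set B : Set (ι → ℝ) := Metric.closedBall 0 (max R 1)
  have hBc : IsCompact B := isCompact_closedBall _ _
  have hgB : ∀ x, x ∉ B → g x = 0 := fun x hx => image_eq_zero_of_notMem_tsupport fun h =>
    hx (Metric.closedBall_subset_closedBall (le_max_left _ _) (hR h))
  have h0B : (0 : ι → ℝ) ∈ B := Metric.mem_closedBall_self (by positivity)
  have hgc := hg.continuous
  have hq : Continuous fun x => ∑ i, (x i + g x i) ^ 2 := by fun_prop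
  have hsq : Continuous fun x : ι → ℝ => ∑ i, (x i) ^ 2 := by fun_prop
  have hdetc : Continuous fun x => (ContinuousLinearMap.id ℝ (ι → ℝ) + fderiv ℝ g x).det :=
    ContinuousLinearMap.continuous_det.comp
      (continuous_const.add (hg.continuous_fderiv (by simp)))
  obtain ⟨x₀, -, hx₀⟩ := hBc.exists_isMinOn ⟨0, h0B⟩ hq.continuousOn
  obtain ⟨x₁, -, hx₁⟩ := hBc.exists_isMaxOn ⟨0, h0B⟩ hq.continuousOn
  obtain ⟨x₂, -, hx₂⟩ := hBc.exists_isMaxOn ⟨0, h0B⟩ hsq.continuousOn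
  set r := ∑ i, (x₀ i + g x₀ i) ^ 2 with hr
  have hrpos : 0 < r := by
    obtain ⟨i, hi⟩ := Function.ne_iff.mp (hne x₀)
    refine Finset.sum_pos' (fun j _ => sq_nonneg _) ⟨i, Finset.mem_univ _, ?_⟩
    exact pow_pos (abs_pos.mpr hi) 2 |>.trans_eq (sq_abs _)
  set M := max (max (∑ i, (x₁ i + g x₁ i) ^ 2) (∑ i, (x₂ i) ^ 2)) r with hM
  have hM1 : ∀ x ∈ B, ∑ i, (x i + g x i) ^ 2 ≤ M := fun x hx =>
    (hx₁ hx).trans ((le_max_left _ _).trans (le_max_left _ _))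
  have hM2 : ∀ x ∈ B, ∑ i, (x i) ^ 2 ≤ M := fun x hx =>
    (hx₂ hx).trans ((le_max_right _ _).trans (le_max_left _ _))
  have hMr : r ≤ M := le_max_right _ _
  set U : Set (ι → ℝ) := {x | ∑ i, (x i) ^ 2 < r / 2} ∩ Metric.ball 0 1 with hU
  have hUo : IsOpen U := (isOpen_lt hsq continuous_const).inter Metric.isOpen_ball
  have hUB : U ⊆ B := fun x hx => Metric.ball_subset_closedBall
    (Metric.ball_subset_ball (le_max_right _ _) hx.2)
  have hUv : 0 < volume.real U := by
    refine ENNReal.toReal_pos (hUo.measure_pos volume ⟨0, ?_, Metric.mem_ball_self one_pos⟩).ne'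
      ((measure_mono hUB).trans_lt hBc.measure_lt_top).ne
    simpa using hrpos
  set D := ∫ x in B, |(ContinuousLinearMap.id ℝ (ι → ℝ) + fderiv ℝ g x).det|
  have hineq : ∀ N : ℕ, (M - r / 2) ^ N * volume.real U ≤ (M - r) ^ N * D := by
    intro N
    have key := setIntegral_pow_perturb_eq hg hgs hBc hgB M N
    have h1 : ∫ x in B, (M - ∑ i, (x i + g x i) ^ 2) ^ N *
        (ContinuousLinearMap.id ℝ (ι → ℝ) + fderiv ℝ g x).det ≤ (M - r) ^ N * D := by
      rw [← integral_const_mul]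
      refine setIntegral_mono_on ?_ ?_ hBc.measurableSet fun x hx => ?_
      · exact (((continuous_const.sub hq).pow N).mul hdetc).continuousOn.integrableOn_compact hBc
      · exact (continuous_const.mul hdetc.abs).continuousOn.integrableOn_compact hBc
      · have h3 := hM1 x hx
        have h4 : r ≤ ∑ i, (x i + g x i) ^ 2 := hx₀ hx
        exact (mul_le_mul_of_nonneg_left (le_abs_self _) (pow_nonneg (by linarith) N)).trans
          (mul_le_mul_of_nonneg_right (pow_le_pow_left₀ (by linarith) (by linarith) N)
            (abs_nonneg _))
    have h2 : (M - r / 2) ^ N * volume.real U ≤ ∫ x in B, (M - ∑ i, (x i) ^ 2) ^ N := by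
      have hint : IntegrableOn (fun x : ι → ℝ => (M - ∑ i, (x i) ^ 2) ^ N) B :=
        ((continuous_const.sub hsq).pow N).continuousOn.integrableOn_compact hBc
      calc (M - r / 2) ^ N * volume.real U = ∫ _ in U, (M - r / 2) ^ N := by
            rw [setIntegral_const, smul_eq_mul, mul_comm]
        _ ≤ ∫ x in U, (M - ∑ i, (x i) ^ 2) ^ N := by
            refine setIntegral_mono_on ?_ (hint.mono_set hUB) hUo.measurableSet fun x hx => ?_
            · exact integrableOn_const ((measure_mono hUB).trans_lt hBc.measure_lt_top).ne
            · have : ∑ i, (x i) ^ 2 < r / 2 := hx.1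
              exact pow_le_pow_left₀ (by linarith) (by linarith) N
        _ ≤ _ := by
            refine setIntegral_mono_set hint ?_ hUB.eventuallyLE
            filter_upwards [ae_restrict_mem hBc.measurableSet] with x hx
            exact pow_nonneg (sub_nonneg.mpr (hM2 x hx)) N
    linarith
  have hpos : 0 < M - r / 2 := by linarith
  have hlim : Tendsto (fun N : ℕ => ((M - r) / (M - r / 2)) ^ N * D) atTop (𝓝 (0 * D)) :=
    (tendsto_pow_atTop_nhds_zero_of_lt_one (by apply div_nonneg <;> linarith)
      (by rw [div_lt_one hpos]; linarith)).mul_const D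
  rw [zero_mul] at hlim
  refine absurd (ge_of_tendsto' hlim fun N => ?_) hUv.not_ge
  rw [div_pow, div_mul_eq_mul_div, le_div_iff₀ (pow_pos hpos N), mul_comm]
  exact hineq N

/-- **Brouwer's fixed point theorem** for a bounded continuous self-map of `ℝⁿ`. -/
theorem exists_isFixedPt_of_continuous_of_norm_le {G : (ι → ℝ) → ι → ℝ} (hG : Continuous G)
    (hb : ∀ x, ‖G x‖ ≤ 1) : ∃ x, G x = x := by
  obtain ⟨χ, hχ1, -, hχs, hχ⟩ := exists_continuous_one_zero_of_isCompact
    (isCompact_closedBall (0 : ι → ℝ) 1) isClosed_empty (Set.disjoint_empty _)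
  have hcont : Continuous fun x => -(χ x • G x) := (χ.continuous.smul hG).neg
  have hs : HasCompactSupport fun x => -(χ x • G x) := by
    have := (hχs.smul_right (f' := G)).neg
    exact this
  have hle : ∀ x, ‖χ x • G x‖ ≤ 1 := fun x => by
    rw [norm_smul, Real.norm_of_nonneg (hχ x).1]
    exact mul_le_one₀ (hχ x).2 (norm_nonneg _) (hb x)
  have hfix : ∃ x, dist x (χ x • G x) = 0 := by
    have hd : Continuous fun x => dist x (χ x • G x) :=
      continuous_id.dist (χ.continuous.smul hG)
    obtain ⟨x₀, -, hmin⟩ := (isCompact_closedBall (0 : ι → ℝ) 2).exists_isMinOn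
      ⟨0, Metric.mem_closedBall_self zero_le_two⟩ hd.continuousOn
    refine ⟨x₀, ?_⟩
    by_contra hne
    have hpos : 0 < dist x₀ (χ x₀ • G x₀) := lt_of_le_of_ne dist_nonneg (Ne.symm hne)
    obtain ⟨g, hg, hgd, hgs⟩ := hcont.exists_contDiff_approx 1
      (ε := fun _ => min (dist x₀ (χ x₀ • G x₀)) 1) continuous_const
      (fun _ => lt_min hpos one_pos)
    obtain ⟨x, hx⟩ := exists_add_eq_zero_of_hasCompactSupport hg (hs.mono hgs)
    have h1 := hgd x
    rw [eq_neg_of_add_eq_zero_right hx, dist_neg_neg] at h1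
    have h2 : x ∈ Metric.closedBall (0 : ι → ℝ) 2 := by
      rw [mem_closedBall_zero_iff]
      have h3 := norm_le_norm_add_norm_sub' x (χ x • G x)
      rw [← dist_eq_norm] at h3
      linarith [hle x, h1.trans_le (min_le_right _ _)]
    exact absurd (hmin h2) (h1.trans_le (min_le_left _ _)).not_ge
  obtain ⟨x, hx⟩ := hfix
  have hx' : x = χ x • G x := dist_eq_zero.mp hx
  have hχx : χ x = 1 := hχ1 (mem_closedBall_zero_iff.mpr (hx' ▸ hle x))
  refine ⟨x, ?_⟩
  rw [hχx, one_smul] at hx'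
  exact hx'.symm

/-- **Brouwer's fixed point theorem** on the standard simplex. -/
theorem exists_mem_stdSimplex_eq [Nonempty ι] {g : (ι → ℝ) → ι → ℝ}
    (hg : ContinuousOn g (stdSimplex ℝ ι)) (hmaps : Set.MapsTo g (stdSimplex ℝ ι) (stdSimplex ℝ ι)) :
    ∃ x ∈ stdSimplex ℝ ι, g x = x := by
  let t : (ι → ℝ) → ℝ := fun x => max (1 - ∑ i, max (x i) 0) 0
  let d : (ι → ℝ) → ℝ := fun x => ∑ i, (max (x i) 0 + t x)
  let r : (ι → ℝ) → ι → ℝ := fun x i => (max (x i) 0 + t x) / d x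
  have ht0 : ∀ x, 0 ≤ t x := fun x => le_max_right _ _
  have hd : ∀ x, 0 < d x := by
    intro x
    have h1 : 1 - ∑ i, max (x i) 0 ≤ t x := le_max_left _ _
    have h2 : d x = ∑ i, max (x i) 0 + Fintype.card ι * t x := by
      simp [d, Finset.sum_add_distrib]
    have h3 : (1 : ℝ) ≤ Fintype.card ι := by exact_mod_cast Fintype.card_pos
    nlinarith [ht0 x]
  have hrc : Continuous r := by
    have ht : Continuous t := by fun_prop
    have hdc : Continuous d := by fun_prop
    exact continuous_pi fun i => Continuous.div (by fun_prop) hdc fun x => (hd x).ne'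
  have hrm : ∀ x, r x ∈ stdSimplex ℝ ι := fun x => by
    refine ⟨fun i => div_nonneg (add_nonneg (le_max_right _ _) (ht0 x)) (hd x).le, ?_⟩
    rw [← Finset.sum_div]
    exact div_self (hd x).ne'
  have hrid : ∀ x ∈ stdSimplex ℝ ι, r x = x := by
    intro x hx
    have h1 : ∀ i, max (x i) 0 = x i := fun i => max_eq_left (hx.1 i)
    have h2 : t x = 0 := by simp [t, h1, hx.2]
    have h3 : d x = 1 := by simp [d, h1, h2, hx.2]
    ext i
    simp [r, h1, h2, h3]
  obtain ⟨x, hx⟩ := exists_isFixedPt_of_continuous_of_norm_le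
    (G := fun x => g (r x)) (hg.comp_continuous hrc hrm) fun x => by
      have h := hmaps (hrm x)
      refine (pi_norm_le_iff_of_nonneg zero_le_one).mpr fun i => ?_
      rw [Real.norm_of_nonneg (h.1 i), ← h.2]
      exact Finset.single_le_sum (fun j _ => h.1 j) (Finset.mem_univ i)
  have hxm : x ∈ stdSimplex ℝ ι := hx ▸ hmaps (hrm x)
  exact ⟨x, hxm, by simpa only [hrid x hxm] using hx⟩

end Brouwer

section Atomless

variable {I : Type*} [MeasurableSpace I] {lam : Measure I} [IsFiniteMeasure lam]

theorem MeasAtomless.exists_subset_real_le_half (hl : MeasAtomless lam) {s : Set I}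
    (hs : MeasurableSet s) (hpos : 0 < lam.real s) :
    ∃ t ⊆ s, MeasurableSet t ∧ 0 < lam.real t ∧ lam.real t ≤ lam.real s / 2 := by
  obtain ⟨t, ht, hts, ht0, hlt⟩ := hl s hs (ENNReal.toReal_pos_iff.mp hpos).1
  have h0 : 0 < lam.real t := ENNReal.toReal_pos ht0.ne' (measure_ne_top _ _)
  have h1 : lam.real t < lam.real s :=
    (ENNReal.toReal_lt_toReal (measure_ne_top _ _) (measure_ne_top _ _)).mpr hlt
  have h2 : lam.real (s \ t) = lam.real s - lam.real t := measureReal_sdiff hts ht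
  rcases le_total (lam.real t) (lam.real s / 2) with h | h
  · exact ⟨t, hts, ht, h0, h⟩
  · exact ⟨s \ t, Set.sdiff_subset, hs.diff ht, by linarith, by linarith⟩

theorem MeasAtomless.exists_subset_real_le (hl : MeasAtomless lam) {s : Set I}
    (hs : MeasurableSet s) (hpos : 0 < lam.real s) {ε : ℝ} (hε : 0 < ε) :
    ∃ t ⊆ s, MeasurableSet t ∧ 0 < lam.real t ∧ lam.real t ≤ ε := by
  have h : ∀ n : ℕ, ∃ t ⊆ s, MeasurableSet t ∧ 0 < lam.real t ∧
      lam.real t ≤ lam.real s * (1 / 2) ^ n := by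
    intro n
    induction n with
    | zero => exact ⟨s, subset_rfl, hs, hpos, by simp⟩
    | succ n ih =>
      obtain ⟨t, hts, ht, ht0, hle⟩ := ih
      obtain ⟨r, hrt, hr, hr0, hrle⟩ := hl.exists_subset_real_le_half ht ht0
      exact ⟨r, hrt.trans hts, hr, hr0, by rw [pow_succ]; linarith⟩
  have hlim : Tendsto (fun n : ℕ => lam.real s * (1 / 2 : ℝ) ^ n) atTop (𝓝 (lam.real s * 0)) :=
    (tendsto_pow_atTop_nhds_zero_of_lt_one (by norm_num) (by norm_num)).const_mul _
  rw [mul_zero] at hlim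
  obtain ⟨n, hn⟩ := (hlim.eventually (ge_mem_nhds hε)).exists
  obtain ⟨t, hts, ht, ht0, hle⟩ := h n
  exact ⟨t, hts, ht, ht0, hle.trans hn⟩

/-- **Sierpiński's theorem**: an atomless finite measure takes all intermediate values. -/
theorem MeasAtomless.exists_subset_real_eq (hl : MeasAtomless lam) {s : Set I}
    (hs : MeasurableSet s) {x : ℝ} (hx0 : 0 ≤ x) (hx : x ≤ lam.real s) :
    ∃ t ⊆ s, MeasurableSet t ∧ lam.real t = x := by
  let St := {t : Set I // t ⊆ s ∧ MeasurableSet t ∧ lam.real t ≤ x}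
  have hstep : ∀ t : St, ∃ t' : St, t.1 ⊆ t'.1 ∧ ∀ r : St, t.1 ⊆ r.1 →
      lam.real r.1 - lam.real t.1 ≤ 2 * (lam.real t'.1 - lam.real t.1) := by
    intro t
    by_cases h : ∃ r : St, t.1 ⊆ r.1 ∧ lam.real t.1 < lam.real r.1
    · obtain ⟨r₀, hr₀, hlt⟩ := h
      let V : Set ℝ := {y | ∃ r : St, t.1 ⊆ r.1 ∧ lam.real r.1 = y}
      have hbdd : BddAbove V := ⟨x, by rintro _ ⟨r, -, rfl⟩; exact r.2.2.2⟩
      have hgt : lam.real t.1 < sSup V := hlt.trans_le (le_csSup hbdd ⟨r₀, hr₀, rfl⟩)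
      obtain ⟨_, ⟨r, hr, rfl⟩, hrlt⟩ := exists_lt_of_lt_csSup (s := V) ⟨_, r₀, hr₀, rfl⟩
        (show (sSup V + lam.real t.1) / 2 < sSup V by linarith)
      refine ⟨r, hr, fun r' hr' => ?_⟩
      have := le_csSup hbdd ⟨r', hr', rfl⟩
      linarith
    · push Not at h
      exact ⟨t, subset_rfl, fun r hr => by linarith [h r hr]⟩
  choose next hnext hmax using hstep
  let seq : ℕ → St := fun n => next^[n] ⟨∅, Set.empty_subset _, .empty, by simpa using hx0⟩
  have hseq : ∀ n, seq (n + 1) = next (seq n) := fun n => Function.iterate_succ_apply' _ _ _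
  have hmono : Monotone fun n => (seq n).1 :=
    monotone_nat_of_le_succ fun n => by simpa only [hseq] using hnext (seq n)
  set T := ⋃ n, (seq n).1 with hT
  have hTs : T ⊆ s := Set.iUnion_subset fun n => (seq n).2.1
  have hTm : MeasurableSet T := .iUnion fun n => (seq n).2.2.1
  have hlim : Tendsto (fun n => lam.real (seq n).1) atTop (𝓝 (lam.real T)) :=
    (ENNReal.tendsto_toReal (measure_ne_top _ _)).comp (tendsto_measure_iUnion_atTop hmono)
  have hTx : lam.real T ≤ x := le_of_tendsto' hlim fun n => (seq n).2.2.2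
  refine ⟨T, hTs, hTm, hTx.antisymm ?_⟩
  by_contra! hlt
  have hdiff : lam.real (s \ T) = lam.real s - lam.real T := measureReal_sdiff hTs hTm
  obtain ⟨r, hrs, hr, hr0, hrle⟩ := hl.exists_subset_real_le (hs.diff hTm) (by linarith)
    (sub_pos.mpr hlt)
  have hun : lam.real (T ∪ r) = lam.real T + lam.real r :=
    measureReal_union (Set.disjoint_left.mpr fun i hi hir => (hrs hir).2 hi) hr
  let W : St := ⟨T ∪ r, Set.union_subset hTs (hrs.trans Set.sdiff_subset), hTm.union hr,
    by rw [hun]; linarith⟩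
  have hle : ∀ n, lam.real W.1 - lam.real (seq n).1 ≤
      2 * (lam.real (seq (n + 1)).1 - lam.real (seq n).1) := fun n => by
    rw [hseq]
    exact hmax _ W ((Set.subset_iUnion (fun n => (seq n).1) n).trans Set.subset_union_left)
  have := le_of_tendsto_of_tendsto' (hlim.const_sub _)
    (((hlim.comp (tendsto_add_atTop_nat 1)).sub hlim).const_mul 2) hle
  rw [sub_self, mul_zero] at this
  change lam.real (T ∪ r) - _ ≤ 0 at this
  linarith

/-- An atomless measure can be split among finitely many labels in prescribed proportions. -/
theorem MeasAtomless.exists_measurable_real_inter_preimage {A : Type*} [MeasurableSpace A]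
    [MeasurableSingletonClass A] (hl : MeasAtomless lam) {T : Finset A} (hT : T.Nonempty)
    {s : Set I} (hs : MeasurableSet s) {x : A → ℝ} (hx : ∀ a, 0 ≤ x a)
    (hsum : ∑ a ∈ T, x a = lam.real s) :
    ∃ f : I → A, Measurable f ∧ (∀ i, f i ∈ T) ∧ ∀ a ∈ T, lam.real (s ∩ f ⁻¹' {a}) = x a := by
  classical
  induction hT using Finset.Nonempty.cons_induction generalizing s with
  | singleton a =>
    refine ⟨fun _ => a, measurable_const, by simp, fun b hb => ?_⟩
    rw [Finset.mem_singleton] at hb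
    subst hb
    simpa using hsum.symm
  | cons a T ha hT ih =>
    rw [Finset.sum_cons] at hsum
    have hnn : 0 ≤ ∑ b ∈ T, x b := Finset.sum_nonneg fun b _ => hx b
    obtain ⟨t, hts, ht, htx⟩ := hl.exists_subset_real_eq hs (hx a) (by linarith)
    obtain ⟨f, hf, hfT, hfx⟩ := ih (hs.diff ht)
      (by rw [measureReal_sdiff hts ht, htx]; linarith)
    refine ⟨t.piecewise (fun _ => a) f, measurable_const.piecewise ht hf, fun i => ?_,
      fun b hb => ?_⟩
    · by_cases hi : i ∈ t
      · simp [hi]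
      · simpa [hi] using Or.inr (hfT i)
    · rcases Finset.mem_cons.mp hb with rfl | hbT
      · rw [← htx]
        congr 1
        ext i
        by_cases hi : i ∈ t
        · simp [hi, hts hi]
        · simp only [Set.mem_inter_iff, Set.mem_preimage, Set.piecewise_eq_of_notMem _ _ _ hi,
            Set.mem_singleton_iff, hi, iff_false, not_and]
          exact fun _ h => ha (h ▸ hfT i)
      · rw [← hfx b hbT]
        congr 1
        ext i
        by_cases hi : i ∈ t
        · have : a ≠ b := fun h => ha (h ▸ hbT)
          simp [hi, this]
        · simp [hi]

end Atomless

theorem socSum_diracProfile {I A : Type*} [MeasurableSpace I] [DecidableEq A]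
    [MeasurableSpace A] [MeasurableSingletonClass A] {lam : Measure I} {f : I → A} (hf : Measurable f) (a : A) :
    socSum lam (diracProfile f) a = lam.real (f ⁻¹' {a}) := by
  rw [← integral_indicator_one (hf (measurableSet_singleton a))]
  refine integral_congr_ae (ae_of_all _ fun i => ?_)
  by_cases h : a = f i
  · simp [diracProfile, h]
  · simp [diracProfile, h, Ne.symm h]

section Selection

variable {I : Type*} [MeasurableSpace I] {A : Type*} [Fintype A] {lam : Measure I}

theorem integral_comp_eq_sum_of_finite [IsFiniteMeasure lam] {κ : Type*} [Fintype κ] {L : I → κ}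
    (hL : ∀ k, MeasurableSet (L ⁻¹' {k})) (F : κ → ℝ) :
    ∫ i, F (L i) ∂lam = ∑ k, lam.real (L ⁻¹' {k}) * F k := by
  classical
  have h : ∀ i, F (L i) = ∑ k, (L ⁻¹' {k}).indicator (fun _ => F k) i := fun i => by
    simp [Set.indicator_apply]
  simp_rw [h]
  rw [integral_finsetSum _ fun k _ => (integrable_const _).indicator (hL k)]
  refine Finset.sum_congr rfl fun k _ => ?_
  rw [integral_indicator_const _ (hL k), smul_eq_mul]

theorem IsProfile.integrable [IsFiniteMeasure lam] {h : I → A → ℝ} (hh : IsProfile lam h) (a : A) :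
    Integrable (fun i => h i a) lam := by
  refine Integrable.of_bound ((measurable_pi_apply a).comp hh.1).aestronglyMeasurable 1
    (ae_of_all _ fun i => ?_)
  rw [Real.norm_of_nonneg ((hh.2 i).1 a)]
  exact (hh.2 i).2 ▸ Finset.single_le_sum (fun j _ => (hh.2 i).1 j) (Finset.mem_univ a)

theorem IsProfile.socSum_mem [IsProbabilityMeasure lam] {h : I → A → ℝ} (hh : IsProfile lam h) :
    socSum lam h ∈ stdSimplex ℝ A := by
  refine ⟨fun a => integral_nonneg fun i => (hh.2 i).1 a, ?_⟩
  simp only [socSum]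
  rw [← integral_finsetSum _ fun a _ => hh.integrable a]
  simp [(hh.2 _).2]

variable [DecidableEq A] [MeasurableSpace A] [MeasurableSingletonClass A]

theorem isProfile_diracProfile {f : I → A} (hf : Measurable f) :
    IsProfile lam (diracProfile f) := by
  refine ⟨measurable_pi_iff.mpr fun a => ?_, fun i => ⟨fun a => ?_, by simp [diracProfile]⟩⟩
  · exact Measurable.ite (measurableSet_eq_fun measurable_const hf) measurable_const
      measurable_const
  · unfold diracProfile
    split_ifs <;> norm_num

/-- A point is the summary of a pure selection of a finite-valued correspondence `L` as soon as
it satisfies every linear inequality satisfied by the integral of `L`. -/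
theorem MeasAtomless.exists_selection_socSum_eq [IsProbabilityMeasure lam]
    (hl : MeasAtomless lam) {L : I → {T : Finset A // T.Nonempty}}
    (hL : ∀ T, MeasurableSet (L ⁻¹' {T})) {τ : A → ℝ}
    (hτ : ∀ c : A → ℝ, ∑ a, c a * τ a ≤ ∫ i, (L i).1.sup' (L i).2 c ∂lam) :
    ∃ f : I → A, Measurable f ∧ (∀ i, f i ∈ (L i).1) ∧ socSum lam (diracProfile f) = τ := by
  let C : {T : Finset A // T.Nonempty} → Set (A → ℝ) := fun T =>
    stdSimplex ℝ A ∩ {p | ∀ a, a ∉ T.1 → p a = 0}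
  let m : {T : Finset A // T.Nonempty} → ℝ := fun T => lam.real (L ⁻¹' {T})
  let Φ : ({T : Finset A // T.Nonempty} → A → ℝ) →ₗ[ℝ] (A → ℝ) :=
    ∑ T, m T • LinearMap.proj T
  have hΦ : ∀ p, Φ p = ∑ T, m T • p T := fun p => by simp [Φ]
  have hCcomp : ∀ T, IsCompact (C T) := fun T => by
    refine (isCompact_stdSimplex ℝ A).inter_right ?_
    simp only [Set.ofPred_forall]
    exact isClosed_iInter fun a => isClosed_iInter fun _ =>
      isClosed_eq (continuous_apply a) continuous_const
  have hCconv : ∀ T, Convex ℝ (C T) := fun T => by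
    refine (convex_stdSimplex ℝ A).inter fun p hp q hq s t _ _ _ a ha => ?_
    simp [hp a ha, hq a ha]
  have hmem : τ ∈ Φ '' Set.univ.pi C := by
    by_contra hnot
    obtain ⟨ℓ, v, h1, h2⟩ := geometric_hahn_banach_closed_point
      ((convex_pi fun T _ => hCconv T).linear_image Φ)
      ((isCompact_univ_pi hCcomp).image (LinearMap.continuous_of_finiteDimensional Φ)).isClosed
      hnot
    set c : A → ℝ := fun a => ℓ (Pi.single a 1) with hc
    have hℓ : ∀ x : A → ℝ, ℓ x = ∑ a, c a * x a := fun x => by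
      conv_lhs => rw [pi_eq_sum_univ' x]
      simp [hc, mul_comm]
    have hmax : ∀ T : {T : Finset A // T.Nonempty}, ∃ a ∈ T.1, T.1.sup' T.2 c = c a :=
      fun T => Finset.exists_mem_eq_sup' T.2 c
    choose b hbT hb using hmax
    have h3 := h1 (Φ fun T => Pi.single (b T) 1) ⟨_, fun T _ =>
      ⟨single_mem_stdSimplex ℝ _, fun a ha =>
        Pi.single_eq_of_ne (fun h : a = b T => ha (h ▸ hbT T)) _⟩, rfl⟩
    have h4 := hτ c
    rw [integral_comp_eq_sum_of_finite hL fun T => T.1.sup' T.2 c] at h4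
    rw [hΦ, map_sum] at h3
    simp only [map_smul, smul_eq_mul] at h3
    rw [hℓ] at h2
    simp only [hb] at h4
    exact absurd (h2.trans_le h4) (not_lt.mpr h3.le)
  obtain ⟨p, hp, hpτ⟩ := hmem
  rw [hΦ] at hpτ
  have hsplit : ∀ T : {T : Finset A // T.Nonempty}, ∃ f : I → A, Measurable f ∧
      (∀ i, f i ∈ T.1) ∧ ∀ a ∈ T.1, lam.real (L ⁻¹' {T} ∩ f ⁻¹' {a}) = m T * p T a := by
    intro T
    have hpT := hp T (Set.mem_univ T)
    refine hl.exists_measurable_real_inter_preimage T.2 (hL T)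
      (fun a => mul_nonneg measureReal_nonneg (hpT.1.1 a)) ?_
    rw [← Finset.mul_sum, Finset.sum_subset (Finset.subset_univ T.1) fun a _ ha => hpT.2 a ha,
      hpT.1.2, mul_one]
  choose F hF hFT hFm using hsplit
  have hpre : ∀ a, (fun i => F (L i) i) ⁻¹' {a} = ⋃ T, L ⁻¹' {T} ∩ F T ⁻¹' {a} := fun a => by
    ext i
    simp
  have hmeas : ∀ T a, MeasurableSet (L ⁻¹' {T} ∩ F T ⁻¹' {a}) := fun T a =>
    (hL T).inter (hF T (measurableSet_singleton a))
  have hf : Measurable fun i => F (L i) i := measurable_to_countable' fun a => by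
    rw [hpre]
    exact .iUnion fun T => hmeas T a
  refine ⟨_, hf, fun i => hFT _ i, ?_⟩
  ext a
  rw [socSum_diracProfile hf, hpre, measureReal_iUnion_fintype (fun T T' hne => ?_)
    fun T => hmeas T a, ← hpτ, Finset.sum_apply]
  · refine Finset.sum_congr rfl fun T _ => ?_
    by_cases ha : a ∈ T.1
    · exact hFm T a ha
    · have hempty : F T ⁻¹' {a} = ∅ := by
        ext i
        simpa using fun h : F T i = a => ha (h ▸ hFT T i)
      simp [hempty, (hp T (Set.mem_univ T)).2 a ha]
  · exact Set.disjoint_left.mpr fun i hi hi' => hne (hi.1.symm.trans hi'.1)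

/-- If the summaries of a sequence of profiles converge, then the limit is the summary of a pure
profile that only uses actions whose probabilities do not vanish along the sequence. -/
theorem MeasAtomless.exists_limit_selection [IsProbabilityMeasure lam] (hl : MeasAtomless lam)
    {h : ℕ → I → A → ℝ} (hh : ∀ n, IsProfile lam (h n)) {τ : A → ℝ}
    (hτ : Tendsto (fun n => socSum lam (h n)) atTop (𝓝 τ)) :
    ∃ f : I → A, Measurable f ∧ (∀ i, ¬ Tendsto (fun n => h n i (f i)) atTop (𝓝 0)) ∧
      socSum lam (diracProfile f) = τ := by
  classical
  let L₀ : I → Finset A := fun i =>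
    Finset.univ.filter fun a => ¬ Tendsto (fun n => h n i a) atTop (𝓝 0)
  have hmem : ∀ i a, a ∈ L₀ i ↔ ¬ Tendsto (fun n => h n i a) atTop (𝓝 0) := fun i a => by
    simp [L₀]
  have hne : ∀ i, (L₀ i).Nonempty := fun i => by
    by_contra hemp
    have h0 : ∀ a, Tendsto (fun n => h n i a) atTop (𝓝 0) := fun a => by
      by_contra ha
      exact hemp ⟨a, (hmem i a).mpr ha⟩
    have h1 := tendsto_finsetSum Finset.univ fun a _ => h0 a
    simp only [((hh _).2 i).2, Finset.sum_const_zero] at h1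
    exact one_ne_zero (tendsto_nhds_unique tendsto_const_nhds h1)
  have hcoord : ∀ n a, Measurable fun i => h n i a := fun n a =>
    (measurable_pi_apply a).comp (hh n).1
  have hset : ∀ a, MeasurableSet {i | a ∈ L₀ i} := fun a => by
    simp only [hmem]
    exact (measurableSet_tendsto (𝓝 0) fun n => hcoord n a).compl
  let L : I → {T : Finset A // T.Nonempty} := fun i => ⟨L₀ i, hne i⟩
  have hL : ∀ T, MeasurableSet (L ⁻¹' {T}) := fun T => by
    have : L ⁻¹' {T} = ⋂ a, {i | a ∈ L₀ i ↔ a ∈ T.1} := by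
      ext i
      simp [L, Subtype.ext_iff, Finset.ext_iff]
    rw [this]
    exact .iInter fun a => (hset a).iff (.const _)
  suffices hsup : ∀ c : A → ℝ, ∑ a, c a * τ a ≤ ∫ i, (L i).1.sup' (L i).2 c ∂lam by
    obtain ⟨f, hf, hfL, hfτ⟩ := hl.exists_selection_socSum_eq hL hsup
    exact ⟨f, hf, fun i => (hmem i _).mp (hfL i), hfτ⟩
  intro c
  set S : I → ℝ := fun i => (L i).1.sup' (L i).2 c with hS
  set D : ℝ := ∑ a, |c a|
  have hcD : ∀ a, |c a| ≤ D := fun a =>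
    Finset.single_le_sum (fun b _ => abs_nonneg (c b)) (Finset.mem_univ a)
  have hSD : ∀ i, |S i| ≤ D := fun i => by
    obtain ⟨b, -, hb⟩ := Finset.exists_mem_eq_sup' (L i).2 c
    rw [hS]
    simpa only [hb] using hcD b
  let e : ℕ → I → ℝ := fun n i => ∑ a, {i | a ∈ L₀ i}ᶜ.indicator (fun i => h n i a) i
  have hem : ∀ n, Measurable (e n) := fun n => Finset.measurable_fun_sum _ fun a _ =>
    (hcoord n a).indicator (hset a).compl
  have he0 : ∀ n i, 0 ≤ e n i := fun n i => Finset.sum_nonneg fun a _ =>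
    Set.indicator_nonneg (fun j _ => ((hh n).2 j).1 a) i
  have he1 : ∀ n i, e n i ≤ 1 := fun n i => by
    rw [← ((hh n).2 i).2]
    exact Finset.sum_le_sum fun a _ =>
      Set.indicator_le_self' (fun j _ => ((hh n).2 j).1 a) i
  have helim : ∀ i, Tendsto (fun n => e n i) atTop (𝓝 0) := fun i => by
    rw [← Finset.sum_const_zero (s := (Finset.univ : Finset A))]
    refine tendsto_finsetSum _ fun a _ => ?_
    by_cases ha : a ∈ L₀ i
    · simp [ha]
    · simpa [ha] using not_not.mp (mt (hmem i a).mpr ha)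
  have hebd : ∀ n, ∀ᵐ i ∂lam, ‖e n i‖ ≤ 1 := fun n => ae_of_all _ fun i => by
    rw [Real.norm_of_nonneg (he0 n i)]
    exact he1 n i
  have heint : Tendsto (fun n => ∫ i, e n i ∂lam) atTop (𝓝 0) := by
    have := tendsto_integral_of_dominated_convergence (μ := lam) (F := e) (f := fun _ => 0)
      (fun _ => (1 : ℝ)) (fun n => (hem n).aestronglyMeasurable) (integrable_const _) hebd
      (ae_of_all _ helim)
    simpa using this
  have hSint : Integrable S lam := by
    let _ : MeasurableSpace {T : Finset A // T.Nonempty} := ⊤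
    have hLm : Measurable L := measurable_to_countable' hL
    have hSm : Measurable S := (Measurable.of_discrete (f := fun T :
      {T : Finset A // T.Nonempty} => T.1.sup' T.2 c)).comp hLm
    exact Integrable.of_bound hSm.aestronglyMeasurable D (ae_of_all _ hSD)
  have hpt : ∀ n i, ∑ a, c a * h n i a ≤ S i + 2 * D * e n i := by
    intro n i
    have hsum : S i + 2 * D * e n i = ∑ a, (S i * h n i a +
        2 * D * {i | a ∈ L₀ i}ᶜ.indicator (fun i => h n i a) i) := by
      rw [Finset.sum_add_distrib, ← Finset.mul_sum, ← Finset.mul_sum, ((hh n).2 i).2, mul_one]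
    rw [hsum]
    refine Finset.sum_le_sum fun a _ => ?_
    have hpos := ((hh n).2 i).1 a
    by_cases ha : a ∈ L₀ i
    · have : c a ≤ S i := Finset.le_sup' c ha
      simpa [ha] using mul_le_mul_of_nonneg_right this hpos
    · have h1 := abs_le.mp (hcD a)
      have h2 := abs_le.mp (hSD i)
      simp only [Set.indicator_apply, Set.mem_compl_iff, Set.mem_ofPred_eq, ha, not_false_eq_true,
        if_true]
      nlinarith
  have hbound : ∀ n, ∑ a, c a * socSum lam (h n) a ≤
      ∫ i, S i ∂lam + 2 * D * ∫ i, e n i ∂lam := by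
    intro n
    have hei : Integrable (e n) lam :=
      Integrable.of_bound (hem n).aestronglyMeasurable 1 (hebd n)
    have hint : ∀ a ∈ Finset.univ, Integrable (fun i => c a * h n i a) lam := fun a _ =>
      ((hh n).integrable a).const_mul _
    have h1 : ∑ a, c a * socSum lam (h n) a = ∫ i, ∑ a, c a * h n i a ∂lam := by
      rw [integral_finsetSum _ hint]
      simp only [socSum, integral_const_mul]
    rw [h1, ← integral_const_mul, ← integral_add hSint (hei.const_mul _)]
    exact integral_mono (integrable_finsetSum _ hint) (hSint.add (hei.const_mul _)) (hpt n)
  refine le_of_tendsto_of_tendsto' (tendsto_finsetSum _ fun a _ =>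
    ((continuous_apply a).tendsto τ |>.comp hτ).const_mul (c a)) ?_ hbound
  simpa using (heint.const_mul (2 * D)).const_add (∫ i, S i ∂lam)

end Selection

section LogitResponse

variable {A : Type*} [Fintype A]

/-- The logit response with precision `n` to the payoff vector `w`. -/
noncomputable def logitResponse (n : ℕ) (w : A → ℝ) : A → ℝ :=
  fun a => Real.exp (n * w a) / ∑ b, Real.exp (n * w b)

theorem continuous_logitResponse [Nonempty A] (n : ℕ) :
    Continuous (logitResponse n : (A → ℝ) → A → ℝ) :=
  continuous_pi fun a => Continuous.div (by fun_prop) (by fun_prop) fun w =>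
    (Finset.sum_pos (fun b _ => Real.exp_pos _) Finset.univ_nonempty).ne'

theorem logitResponse_mem_stdSimplex [Nonempty A] (n : ℕ) (w : A → ℝ) :
    logitResponse n w ∈ stdSimplex ℝ A := by
  have h : 0 < ∑ b, Real.exp (n * w b) :=
    Finset.sum_pos (fun b _ => Real.exp_pos _) Finset.univ_nonempty
  refine ⟨fun a => div_nonneg (Real.exp_pos _).le h.le, ?_⟩
  simp only [logitResponse, ← Finset.sum_div]
  exact div_self h.ne'

theorem logitResponse_le_exp (n : ℕ) (w : A → ℝ) (a b : A) :
    logitResponse n w a ≤ Real.exp (n * (w a - w b)) := by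
  have h : Real.exp (n * w b) ≤ ∑ b, Real.exp (n * w b) :=
    Finset.single_le_sum (f := fun b => Real.exp (n * w b)) (fun b _ => (Real.exp_pos _).le)
      (Finset.mem_univ b)
  rw [mul_sub, Real.exp_sub]
  exact div_le_div_of_nonneg_left (Real.exp_pos _).le (Real.exp_pos _) h

end LogitResponse

section Existence

variable {I : Type*} [MeasurableSpace I] {A : Type*} [Fintype A] [Nonempty A]

theorem IsLargeGame.isProfile_logit {lam : Measure I} {v : I → A → (A → ℝ) → ℝ}
    (hv : IsLargeGame v) (n : ℕ) {τ : A → ℝ} (hτ : τ ∈ stdSimplex ℝ A) :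
    IsProfile lam fun i => logitResponse n fun a => v i a τ :=
  ⟨(continuous_logitResponse n).measurable.comp (measurable_pi_lambda _ fun a => hv.2 a τ hτ),
    fun _ => logitResponse_mem_stdSimplex n _⟩

/-- Every large game has a summary that is reproduced by the logit responses to it. -/
theorem IsLargeGame.exists_logit_fixedPoint {lam : Measure I} [IsProbabilityMeasure lam]
    {v : I → A → (A → ℝ) → ℝ} (hv : IsLargeGame v) (n : ℕ) :
    ∃ τ ∈ stdSimplex ℝ A, socSum lam (fun i => logitResponse n fun a => v i a τ) = τ := by
  refine exists_mem_stdSimplex_eq (continuousOn_pi.mpr fun a => ?_)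
    fun τ hτ => (hv.isProfile_logit n hτ).socSum_mem
  refine continuousOn_of_dominated (bound := fun _ => (1 : ℝ))
    (fun τ hτ => ((hv.isProfile_logit n hτ).integrable a).aestronglyMeasurable)
    (fun τ hτ => ae_of_all _ fun i => ?_) (integrable_const _) (ae_of_all _ fun i => ?_)
  · have h := logitResponse_mem_stdSimplex n fun a => v i a τ
    rw [Real.norm_of_nonneg (h.1 a), ← h.2]
    exact Finset.single_le_sum (fun j _ => h.1 j) (Finset.mem_univ a)
  · exact ((continuous_apply a).comp (continuous_logitResponse n)).comp_continuousOn
      (continuousOn_pi.mpr fun b => hv.1 i b)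

/-- Every large game has a pure strategy Nash equilibrium. -/
theorem IsLargeGame.exists_pure_nash [DecidableEq A] [MeasurableSpace A]
    [MeasurableSingletonClass A] {lam : Measure I} [IsProbabilityMeasure lam]
    (hl : MeasAtomless lam) {v : I → A → (A → ℝ) → ℝ} (hv : IsLargeGame v) :
    ∃ f : I → A, Measurable f ∧ ∀ i b,
      v i b (socSum lam (diracProfile f)) ≤ v i (f i) (socSum lam (diracProfile f)) := by
  choose σ hσ hfix using fun n => hv.exists_logit_fixedPoint (lam := lam) n
  obtain ⟨τ, hτ, ψ, hψ, hlim⟩ := (isCompact_stdSimplex ℝ A).tendsto_subseq hσ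
  obtain ⟨f, hf, hfi, hfτ⟩ := hl.exists_limit_selection
    (h := fun n i => logitResponse (ψ n) fun a => v i a (σ (ψ n)))
    (fun n => hv.isProfile_logit _ (hσ _)) (τ := τ) (by simp only [hfix]; exact hlim)
  refine ⟨f, hf, fun i b => ?_⟩
  rw [hfτ]
  by_contra! hlt
  refine hfi i ?_
  have hconv : ∀ a, Tendsto (fun n => v i a (σ (ψ n))) atTop (𝓝 (v i a τ)) := fun a =>
    (hv.1 i a τ hτ).tendsto.comp
      (tendsto_nhdsWithin_iff.mpr ⟨hlim, Eventually.of_forall fun n => hσ _⟩)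
  have hbot : Tendsto (fun n => (ψ n : ℝ) * (v i (f i) (σ (ψ n)) - v i b (σ (ψ n))))
      atTop atBot :=
    (tendsto_natCast_atTop_atTop.comp hψ.tendsto_atTop).atTop_mul_neg (sub_neg.mpr hlt)
      ((hconv _).sub (hconv b))
  exact squeeze_zero (fun n => (logitResponse_mem_stdSimplex _ _).1 _)
    (fun n => logitResponse_le_exp _ _ _ b) (Real.tendsto_exp_atBot.comp hbot)

end Existence

section Perturbation

variable {A : Type*} [Fintype A]

theorem integrable_of_continuousOn_stdSimplex {ν : Measure (A → ℝ)} [IsFiniteMeasure ν]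
    (hν : ν (stdSimplex ℝ A)ᶜ = 0) {f : (A → ℝ) → ℝ} (hf : ContinuousOn f (stdSimplex ℝ A)) :
    Integrable f ν := by
  have h : IntegrableOn f (stdSimplex ℝ A) ν :=
    hf.integrableOn_compact (isCompact_stdSimplex ℝ A)
  have hmem : ∀ᵐ x ∂ν, x ∈ stdSimplex ℝ A := mem_ae_iff.mpr hν
  rwa [IntegrableOn, Measure.restrict_eq_self_of_ae_mem hmem] at h

/-- There is a discrete probability measure with full support on the simplex. -/
theorem exists_fullSupportOnSimplex_s1 [Nonempty A] :
    ∃ η : Measure (A → ℝ), FullSupportOnSimplex η ∧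
      ∃ (d : ℕ → A → ℝ) (c : ℕ → ℝ), (∀ n, d n ∈ stdSimplex ℝ A) ∧
        ∀ f : (A → ℝ) → ℝ, ContinuousOn f (stdSimplex ℝ A) →
          HasSum (fun n => c n * f (d n)) (∫ x, f x ∂η) := by
  classical
  have : Nonempty (stdSimplex ℝ A) :=
    ⟨⟨_, single_mem_stdSimplex ℝ (Classical.arbitrary A)⟩⟩
  let d : ℕ → stdSimplex ℝ A := TopologicalSpace.denseSeq _
  let w : ℕ → ENNReal := fun n => 2⁻¹ ^ (n + 1)
  let η : Measure (A → ℝ) := Measure.sum fun n => w n • Measure.dirac (d n).1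
  have hw : ∀ n, 0 < w n := fun n => ENNReal.pow_pos (by simp) _
  have hprob : IsProbabilityMeasure η := ⟨by
    rw [Measure.sum_apply _ MeasurableSet.univ]
    simp [w, ENNReal.tsum_geometric_add_one, ENNReal.inv_mul_cancel]⟩
  have hcompl : η (stdSimplex ℝ A)ᶜ = 0 := by
    rw [Measure.sum_apply _ (isClosed_stdSimplex ℝ A).measurableSet.compl]
    simp [(d _).2]
  refine ⟨η, ⟨hprob, hcompl, fun U hU hne => ?_⟩, fun n => (d n).1, fun n => (w n).toReal,
    fun n => (d n).2, fun f hf => ?_⟩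
  · obtain ⟨x, hxU, hx⟩ := hne
    obtain ⟨n, hn⟩ := (TopologicalSpace.denseRange_denseSeq (stdSimplex ℝ A)).exists_mem_open
      (hU.preimage continuous_subtype_val) ⟨⟨x, hx⟩, hxU⟩
    refine (hw n).trans_le ?_
    calc w n = (w n • Measure.dirac (d n).1) U := by
          have : (d n).1 ∈ U := hn
          simp [this]
      _ ≤ η U := Measure.le_sum_apply _ _ |>.trans' (ENNReal.le_tsum n)
  · have := hasSum_integral_measure (integrable_of_continuousOn_stdSimplex hcompl hf)
    simpa [integral_smul_measure] using this

/-- Mixing a degenerate belief with a fixed measure. -/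
noncomputable def mixDirac (ε : ℝ) (η : Measure (A → ℝ)) (τ : A → ℝ) : Measure (A → ℝ) :=
  ENNReal.ofReal (1 - ε) • Measure.dirac τ + ENNReal.ofReal ε • η

theorem integral_mixDirac {ε : ℝ} (h0 : 0 ≤ ε) (h1 : ε ≤ 1) {η : Measure (A → ℝ)}
    {f : (A → ℝ) → ℝ} (hf : Integrable f η) (τ : A → ℝ) :
    ∫ x, f x ∂(mixDirac ε η τ) = (1 - ε) * f τ + ε * ∫ x, f x ∂η := by
  rw [mixDirac, integral_add_measure ((integrable_dirac (by simp)).smul_measure (by simp))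
    (hf.smul_measure (by simp)), integral_smul_measure, integral_smul_measure, integral_dirac,
    ENNReal.toReal_ofReal h0, ENNReal.toReal_ofReal (sub_nonneg.mpr h1)]
  simp

theorem isPerturbation_mixDirac {ε : ℝ} (h0 : 0 < ε) (h1 : ε ≤ 1) {η : Measure (A → ℝ)}
    (hη : FullSupportOnSimplex η) : IsPerturbation (mixDirac ε η) := by
  obtain ⟨hprob, hcompl, hfull⟩ := hη
  refine ⟨fun τ hτ => ⟨⟨?_⟩, ?_, fun U hU hne => ?_⟩, fun f hf => ?_⟩
  · simp [mixDirac, ← ENNReal.ofReal_add (sub_nonneg.mpr h1) h0.le]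
  · have hm := (isClosed_stdSimplex ℝ A).measurableSet.compl
    simp [mixDirac, hcompl, Measure.dirac_apply' τ hm, hτ]
  · have : 0 < ENNReal.ofReal ε * η U :=
      ENNReal.mul_pos (ENNReal.ofReal_pos.mpr h0).ne' (hfull U hU hne).ne'
    exact this.trans_le (by simp [mixDirac])
  · simp only [integral_mixDirac h0.le h1
      (integrable_of_continuousOn_stdSimplex hcompl hf.continuousOn)]
    exact (hf.measurable.const_mul _).add_const _

theorem ofReal_le_mixDirac_singleton (ε : ℝ) (η : Measure (A → ℝ)) (τ : A → ℝ) :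
    ENNReal.ofReal (1 - ε) ≤ mixDirac ε η τ {τ} := by
  simp [mixDirac]

/-- Mixing a strategy with the uniform one. -/
noncomputable def mixUniform (ε : ℝ) (x : A → ℝ) : A → ℝ :=
  fun a => (1 - ε) * x a + ε / Fintype.card A

theorem mixUniform_mem_stdSimplex [Nonempty A] {ε : ℝ} (h0 : 0 ≤ ε) (h1 : ε ≤ 1) {x : A → ℝ}
    (hx : x ∈ stdSimplex ℝ A) : mixUniform ε x ∈ stdSimplex ℝ A := by
  refine ⟨fun a => add_nonneg (mul_nonneg (sub_nonneg.mpr h1) (hx.1 a)) (by positivity), ?_⟩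
  have : (Fintype.card A : ℝ) ≠ 0 := by exact_mod_cast Fintype.card_ne_zero
  simp only [mixUniform, Finset.sum_add_distrib, ← Finset.mul_sum, hx.2, Finset.sum_const,
    Finset.card_univ, nsmul_eq_mul]
  field_simp
  ring

theorem continuous_mixUniform (ε : ℝ) : Continuous (mixUniform ε : (A → ℝ) → A → ℝ) := by
  unfold mixUniform
  fun_prop

theorem IsProfile.socSum_mixUniform {I : Type*} [MeasurableSpace I] {lam : Measure I}
    [IsProbabilityMeasure lam] {h : I → A → ℝ} (hh : IsProfile lam h) (ε : ℝ) :
    socSum lam (fun i => mixUniform ε (h i)) = mixUniform ε (socSum lam h) := by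
  ext a
  simp only [socSum, mixUniform]
  rw [integral_add ((hh.integrable a).const_mul _) (integrable_const _), integral_const_mul]
  simp

end Perturbation

/-- For every `ε ∈ (0, 1)` there is a pure profile whose mixture with the uniform strategy is an
`ε`-robust perfect equilibrium in which no player is discarded. -/
theorem exists_isEpsRPE_mixUniform {I : Type*} [MeasurableSpace I]
    {A : Type*} [Fintype A] [Nonempty A] [DecidableEq A]
    [MeasurableSpace A] [MeasurableSingletonClass A]
    {lam : Measure I} [IsProbabilityMeasure lam] (hl : MeasAtomless lam)
    {u : I → A → (A → ℝ) → ℝ} (hu : IsLargeGame u) {ε : ℝ} (h0 : 0 < ε) (h1 : ε < 1) :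
    ∃ f : I → A, Measurable f ∧ ∃ φ,
      IsEpsRPE lam u ε (fun i => mixUniform ε (diracProfile f i)) Set.univ φ := by
  obtain ⟨η, hη, d, c, hd, hsum⟩ := exists_fullSupportOnSimplex_s1 (A := A)
  have hηp : IsProbabilityMeasure η := hη.1
  have hpay : ∀ i a τ, payM (u i) a (mixDirac ε η τ) =
      (1 - ε) * u i a τ + ε * ∫ x, u i a x ∂η := fun i a τ =>
    integral_mixDirac h0.le h1.le (integrable_of_continuousOn_stdSimplex hη.2.1 (hu.1 i a)) τ
  have hw : ∀ a, Measurable fun i => ∫ x, u i a x ∂η := fun a =>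
    measurable_of_tendsto_metrizable
      (fun N => Finset.measurable_fun_sum (Finset.range N) fun n _ =>
        (hu.2 a (d n) (hd n)).const_mul (c n))
      (tendsto_pi_nhds.mpr fun i => (hsum _ (hu.1 i a)).tendsto_sum_nat)
  have hv : IsLargeGame fun i a τ => payM (u i) a (mixDirac ε η (mixUniform ε τ)) := by
    simp only [hpay]
    refine ⟨fun i a => (((hu.1 i a).comp (continuous_mixUniform ε).continuousOn fun τ hτ =>
      mixUniform_mem_stdSimplex h0.le h1.le hτ).const_mul _).add continuousOn_const,
      fun a τ hτ => ((hu.2 a _ (mixUniform_mem_stdSimplex h0.le h1.le hτ)).const_mul _).add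
        ((hw a).const_mul _)⟩
  obtain ⟨f, hf, hnash⟩ := hv.exists_pure_nash hl
  have hprof := isProfile_diracProfile (lam := lam) hf
  have hcard : (1 : ℝ) ≤ Fintype.card A := by exact_mod_cast Fintype.card_pos
  refine ⟨f, hf, mixDirac ε η, ⟨(continuous_mixUniform ε).measurable.comp hprof.1, fun i =>
    mixUniform_mem_stdSimplex h0.le h1.le (hprof.2 i)⟩, ae_of_all _ fun i a =>
    add_pos_of_nonneg_of_pos (mul_nonneg (by linarith) ((hprof.2 i).1 a)) (by positivity),
    .univ, ?_, isPerturbation_mixDirac h0 h1.le hη,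
    fun τ _ => ofReal_le_mixDirac_singleton ε η τ, fun i _ am al hlt => ?_⟩
  · rw [measure_univ, ENNReal.ofReal_lt_one]
    linarith
  · rw [hprof.socSum_mixUniform] at hlt
    have hne : am ≠ f i := fun h => absurd (hnash i al) (not_le.mpr (h ▸ hlt))
    simpa [mixUniform, diracProfile, hne] using div_le_self h0.le hcard

/-- Every large game possesses a pure strategy robust perfect
equilibrium: a measurable `f : I → A` whose associated Dirac randomized strategy
profile is a robust perfect equilibrium. -/
theorem statement1 {I : Type*} [MeasurableSpace I]
    {A : Type*} [Fintype A] [Nonempty A] [DecidableEq A]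
    [MeasurableSpace A] [MeasurableSingletonClass A]
    (lam : Measure I) [IsProbabilityMeasure lam] (hatomless : MeasAtomless lam)
    (u : I → A → (A → ℝ) → ℝ) (hu : IsLargeGame u) :
    ∃ f : I → A, Measurable f ∧ IsRPE lam u (diracProfile f) := by
  have hε : ∀ n : ℕ, (0 : ℝ) < 1 / (n + 2) ∧ (1 : ℝ) / (n + 2) < 1 := fun n => by
    have : (0 : ℝ) ≤ n := n.cast_nonneg
    exact ⟨by positivity, by rw [div_lt_one (by positivity)]; linarith⟩
  choose F hF φ hφ using fun n : ℕ => exists_isEpsRPE_mixUniform hatomless hu (hε n).1 (hε n).2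
  have hprof := fun n => isProfile_diracProfile (lam := lam) (hF n)
  obtain ⟨τ, -, ψ, hψ, hlim⟩ := (isCompact_stdSimplex ℝ A).tendsto_subseq
    fun n => (hprof n).socSum_mem
  obtain ⟨f, hf, hfi, hfτ⟩ := hatomless.exists_limit_selection (fun n => hprof (ψ n)) hlim
  have hεlim : Tendsto (fun n => (1 : ℝ) / (ψ n + 2)) atTop (𝓝 0) := by
    have h : Tendsto (fun n : ℕ => (1 : ℝ) / (n + 2)) atTop (𝓝 0) :=
      tendsto_const_nhds.div_atTop
        (tendsto_atTop_add_const_right _ _ tendsto_natCast_atTop_atTop)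
    exact h.comp hψ.tendsto_atTop
  have hmix : ∀ {δ : ℕ → ℝ} {x : ℕ → A → ℝ} {y : A → ℝ}, Tendsto δ atTop (𝓝 0) →
      Tendsto x atTop (𝓝 y) → Tendsto (fun n => mixUniform (δ n) (x n)) atTop (𝓝 y) := by
    intro δ x y hδ hx
    refine tendsto_pi_nhds.mpr fun a => ?_
    simpa [mixUniform] using ((hδ.const_sub 1).mul (tendsto_pi_nhds.mp hx a)).add
      (hδ.div_const (Fintype.card A : ℝ))
  refine ⟨f, hf, isProfile_diracProfile hf, fun n => 1 / (ψ n + 2),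
    fun n i => mixUniform (1 / (ψ n + 2)) (diracProfile (F (ψ n)) i), fun _ => Set.univ,
    fun n => φ (ψ n), fun n => (hε _).1, hεlim, fun n => hφ (ψ n), ae_of_all _ fun i => ?_, ?_⟩
  · have hfreq : ∃ᶠ n in atTop, F (ψ n) i = f i := fun hev => hfi i <|
      tendsto_const_nhds.congr' <| hev.mono fun n hn => by simp [diracProfile, Ne.symm hn]
    obtain ⟨nk, hnk, heq⟩ := extraction_of_frequently_atTop hfreq
    have hdirac : Tendsto (fun k => diracProfile (F (ψ (nk k))) i) atTop
        (𝓝 (diracProfile f i)) :=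
      tendsto_const_nhds.congr fun k => by ext a; simp [diracProfile, heq k]
    exact ⟨nk, hnk, fun _ => Set.mem_univ i, hmix (hεlim.comp hnk.tendsto_atTop) hdirac⟩
  · rw [hfτ]
    exact (hmix hεlim hlim).congr fun n => ((hprof (ψ n)).socSum_mixUniform _).symm
end

section
/- In any large game, every randomized strategy robust perfect equilibrium is a randomized strategy Nash equilibrium. -/
open MeasureTheory Filter Topology

section PerturbationLimits

variable {I : Type*} [MeasurableSpace I] {A : Type*} [Fintype A]

lemma IsProfile.socSum_mem_stdSimplex {lam : Measure I} [IsProbabilityMeasure lam]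
    {h : I → A → ℝ} (hh : IsProfile lam h) : socSum lam h ∈ stdSimplex ℝ A := by
  have hint : ∀ a, Integrable (fun i => h i a) lam := fun a =>
    Integrable.of_bound ((measurable_pi_apply a).comp hh.1).aestronglyMeasurable 1
      (Eventually.of_forall fun i => by
        have hi := mem_Icc_of_mem_stdSimplex (hh.2 i) a
        rw [Real.norm_of_nonneg hi.1]
        exact hi.2)
  refine ⟨fun a => integral_nonneg fun i => (hh.2 i).1 a, ?_⟩
  simp only [socSum]
  rw [← integral_finsetSum _ fun a _ => hint a]
  simp [(hh.2 _).2]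

/-- If a probability measure on a compact set `K` puts mass at least `1 - ε` on a point `σ`,
the integral of a function bounded by `C` on `K` differs from its value at `σ` by at most
`2 * C * ε`. -/
lemma abs_integral_sub_le_of_le_measure_singleton {K : Set (A → ℝ)} (hK : IsCompact K)
    {ν : Measure (A → ℝ)} [IsProbabilityMeasure ν] (hνK : ν Kᶜ = 0)
    {f : (A → ℝ) → ℝ} (hf : ContinuousOn f K) {C : ℝ} (hC : ∀ x ∈ K, |f x| ≤ C)
    {σ : A → ℝ} (hσ : σ ∈ K) {ε : ℝ} (hε : ENNReal.ofReal (1 - ε) ≤ ν {σ}) :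
    |∫ x, f x ∂ν - f σ| ≤ 2 * C * ε := by
  have hae : ∀ᵐ x ∂ν, x ∈ K := by rwa [ae_iff]
  have hint : Integrable f ν := by
    have := hf.integrableOn_compact (μ := ν) hK
    rwa [IntegrableOn, Measure.restrict_eq_self_of_ae_mem hae] at this
  have hC0 : 0 ≤ C := (abs_nonneg _).trans (hC σ hσ)
  have hsub : ∫ x, f x ∂ν - f σ = ∫ x, (f x - f σ) ∂ν := by
    rw [integral_sub hint (integrable_const _)]
    simp
  have hcompl : ∫ x, (f x - f σ) ∂ν = ∫ x in ({σ} : Set (A → ℝ))ᶜ, (f x - f σ) ∂ν :=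
    (setIntegral_eq_integral_of_forall_compl_eq_zero fun x hx => by
      rw [Set.notMem_compl_iff, Set.mem_singleton_iff] at hx
      simp [hx]).symm
  have hmass : ν.real ({σ} : Set (A → ℝ))ᶜ ≤ ε := by
    rw [probReal_compl_eq_one_sub (measurableSet_singleton σ)]
    have := (ENNReal.ofReal_le_iff_le_toReal (measure_ne_top ν _)).1 hε
    rw [measureReal_def]
    linarith
  rw [hsub, hcompl]
  have hbound : ∀ᵐ x ∂ν, x ∈ ({σ} : Set (A → ℝ))ᶜ → ‖f x - f σ‖ ≤ 2 * C := by
    filter_upwards [hae] with x hx _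
    calc ‖f x - f σ‖ ≤ ‖f x‖ + ‖f σ‖ := norm_sub_le _ _
      _ ≤ 2 * C := by
        have h₁ := hC x hx
        have h₂ := hC σ hσ
        simp only [Real.norm_eq_abs]
        linarith
  calc |∫ x in ({σ} : Set (A → ℝ))ᶜ, (f x - f σ) ∂ν|
      ≤ 2 * C * ν.real ({σ} : Set (A → ℝ))ᶜ :=
        norm_setIntegral_le_of_norm_le_const_ae' (measure_lt_top ν _) hbound
    _ ≤ 2 * C * ε := by gcongr

/-- Expected payoffs converge when the beliefs concentrate on a convergent sequence of
societal summaries. -/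
lemma tendsto_payM {v : A → (A → ℝ) → ℝ} {a : A} (hv : ContinuousOn (v a) (stdSimplex ℝ A))
    {ν : ℕ → Measure (A → ℝ)} (hν : ∀ n, FullSupportOnSimplex (ν n))
    {ε : ℕ → ℝ} (hε : Tendsto ε atTop (𝓝 0))
    {σ : ℕ → A → ℝ} {τ : A → ℝ} (hσ : ∀ n, σ n ∈ stdSimplex ℝ A) (hτ : τ ∈ stdSimplex ℝ A)
    (hστ : Tendsto σ atTop (𝓝 τ)) (hmass : ∀ n, ENNReal.ofReal (1 - ε n) ≤ ν n {σ n}) :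
    Tendsto (fun n => payM v a (ν n)) atTop (𝓝 (v a τ)) := by
  have hK : IsCompact (stdSimplex ℝ A) := isCompact_stdSimplex ℝ A
  obtain ⟨C, hC⟩ := hK.exists_bound_of_continuousOn hv
  have hvσ : Tendsto (fun n => v a (σ n)) atTop (𝓝 (v a τ)) :=
    (hv τ hτ).tendsto.comp
      (tendsto_nhdsWithin_iff.2 ⟨hστ, Eventually.of_forall hσ⟩)
  have hdiff : Tendsto (fun n => payM v a (ν n) - v a (σ n)) atTop (𝓝 0) := by
    refine squeeze_zero_norm (a := fun n => 2 * C * ε n) (fun n => ?_)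
      (by simpa using hε.const_mul (2 * C))
    have := (hν n).1
    exact abs_integral_sub_le_of_le_measure_singleton hK (hν n).2.1 hv hC (hσ n) (hmass n)
  simpa using hdiff.add hvσ

/-- A mixed action supported on the maximizers of `w` is optimal. -/
lemma sum_mul_le_sum_mul_of_support_maximizers {p w : A → ℝ} (hp : p ∈ stdSimplex ℝ A)
    (hsupp : ∀ a b, w a < w b → p a = 0) {μ : A → ℝ} (hμ : μ ∈ stdSimplex ℝ A) :
    ∑ a, μ a * w a ≤ ∑ a, p a * w a := by
  obtain ⟨c, hc⟩ : ∃ c, p c ≠ 0 := by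
    by_contra! h0
    simpa [h0] using hp.2
  have hmax : ∀ b, w b ≤ w c := fun b => not_lt.1 fun hlt => hc (hsupp c b hlt)
  have hpw : ∀ a, p a * w a = p a * w c := fun a => by
    rcases (hmax a).lt_or_eq with hlt | heq
    · simp [hsupp a c hlt]
    · rw [heq]
  calc ∑ a, μ a * w a ≤ ∑ a, μ a * w c :=
        Finset.sum_le_sum fun a _ => mul_le_mul_of_nonneg_left (hmax a) (hμ.1 a)
    _ = ∑ a, p a * w c := by rw [← Finset.sum_mul, ← Finset.sum_mul, hμ.2, hp.2]
    _ = ∑ a, p a * w a := by simp only [hpw]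

end PerturbationLimits

/-- In any large game, every randomized strategy robust perfect
equilibrium is a randomized strategy Nash equilibrium. -/
theorem statement2 {I : Type*} [MeasurableSpace I] {A : Type*} [Fintype A] [Nonempty A]
    (lam : Measure I) [IsProbabilityMeasure lam] (hatomless : MeasAtomless lam)
    (u : I → A → (A → ℝ) → ℝ) (hu : IsLargeGame u)
    (h : I → A → ℝ) (hrpe : IsRPE lam u h) :
    IsNash lam u h := by
  obtain ⟨hprof, ε, hs, Is, φs, -, hε, hEps, hconv, hsoc⟩ := hrpe
  refine ⟨hprof, ?_⟩
  filter_upwards [hconv] with i hi μ hμ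
  obtain ⟨nk, hnk, hmem, hlim⟩ := hi
  have hσ : ∀ n, socSum lam (hs n) ∈ stdSimplex ℝ A := fun n => (hEps n).1.socSum_mem_stdSimplex
  have hpay : ∀ a, Tendsto (fun n => payM (u i) a (φs n (socSum lam (hs n)))) atTop
      (𝓝 (u i a (socSum lam h))) := fun a =>
    tendsto_payM (hu.1 i a) (fun n => (hEps n).2.2.2.2.1.1 _ (hσ n)) hε hσ
      hprof.socSum_mem_stdSimplex hsoc fun n => (hEps n).2.2.2.2.2.1 _ (hσ n)
  refine sum_mul_le_sum_mul_of_support_maximizers (hprof.2 i) (fun a b hab => ?_) hμ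
  refine le_antisymm ?_ ((hprof.2 i).1 a)
  have hlt := hnk.tendsto_atTop.eventually ((hpay a).eventually_lt (hpay b) hab)
  refine le_of_tendsto_of_tendsto (tendsto_pi_nhds.1 hlim a) (hε.comp hnk.tendsto_atTop) ?_
  filter_upwards [hlt] with k hk
  exact (hEps (nk k)).2.2.2.2.2.2 i (hmem k) a b hk
end
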